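/- (Lower energy estimate near the solitary manifold.) Assume the Jellium and Wiener conditions. There exist ν > 0 and δ > 0 such that for every N·ℤ³-periodic C¹ function ψ : ℝ³ → ℂ with ∫_{T_N}|ψ(x)|² dx = Z·N³ and all q, p : Γ_N → ℝ³ with d(ψ,q,p) ≤ δ, one has E(ψ,q,p) ≥ ν·d(ψ,q,p)². -/

import Mathlib

noncomputable section

namespace SPN

open MeasureTheory Finset
open scoped Real

/-- Points of `ℝ³`. -/
abbrev V3 : Type := Fin 3 → ℝ

/-- Euclidean dot product on `ℝ³`. -/
def dotP (v w : V3) : ℝ := ∑ i, v i * w i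

/-- Squared Euclidean norm on `ℝ³`. -/
def nsqV (v : V3) : ℝ := ∑ i, v i ^ 2

/-- The fundamental cube `[0,N)³` of the torus `T_N = ℝ³/(N·ℤ³)`. -/
def cubeN (N : ℕ) : Set V3 := {x | ∀ i, x i ∈ Set.Ico (0 : ℝ) (N : ℝ)}

/-- `N·ℤ³`-periodicity of a function on `ℝ³`. -/
def IsPerN {α : Type*} (N : ℕ) (f : V3 → α) : Prop :=
  ∀ (x : V3) (k : Fin 3 → ℤ), f (x + fun i => (N : ℝ) * (k i : ℝ)) = f x

/-- Index set for `Γ_N = {0,…,N−1}³`. -/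
abbrev GammaIdx (N : ℕ) : Type := Fin 3 → Fin N

/-- The lattice point of `Γ_N` associated to an index. -/
def embG {N : ℕ} (n : GammaIdx N) : V3 := fun i => ((n i : ℕ) : ℝ)

/-- Fourier coefficient `f̂(ξ) = ∫_{T_N} e^{iξ·x} f(x) dx`. -/
def fCoeff (N : ℕ) (f : V3 → ℂ) (ξ : V3) : ℂ :=
  ∫ x in cubeN N, Complex.exp (Complex.I * ((dotP ξ x : ℝ) : ℂ)) * f x

/-- Fourier coefficient of a real-valued function. -/
def fCoeffR (N : ℕ) (f : V3 → ℝ) (ξ : V3) : ℂ :=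
  fCoeff N (fun x => ((f x : ℝ) : ℂ)) ξ

/-- The point `(2π/N)·k` of the dual lattice `Γ*_N`. -/
def xiN (N : ℕ) (k : Fin 3 → ℤ) : V3 := fun i => (2 * π / (N : ℝ)) * (k i : ℝ)

/-- The Jellium condition: `σ̂(ξ) = 0` for all `ξ ∈ Γ*_1 \ {0}`. -/
def JelliumCond (N : ℕ) (σ : V3 → ℝ) : Prop :=
  ∀ k : Fin 3 → ℤ, k ≠ 0 → fCoeffR N σ (fun i => 2 * π * (k i : ℝ)) = 0

/-- `(2π/N)·k ∈ Γ*_1`, i.e. every coordinate of `k` is divisible by `N`. -/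
def inGamma1 (N : ℕ) (k : Fin 3 → ℤ) : Prop := ∀ i, (N : ℤ) ∣ k i

/-- `|∇φ(x)|²` for a complex-valued function. -/
def gradSq (φ : V3 → ℂ) (x : V3) : ℝ :=
  ∑ i, Complex.normSq (fderiv ℝ φ x (Pi.single i 1))

/-- Gradient of a real-valued function on `ℝ³`. -/
def gradV (f : V3 → ℝ) (x : V3) : V3 := fun i => fderiv ℝ f x (Pi.single i 1)

/-- Total charge density `ρ(x) = ∑_n σ(x−n−q(n)) − e|ψ(x)|²`. -/
def rhoT (N : ℕ) (σ : V3 → ℝ) (e : ℝ) (ψ : V3 → ℂ) (q : GammaIdx N → V3) (x : V3) : ℝ :=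
  (∑ n : GammaIdx N, σ (x - embG n - q n)) - e * Complex.normSq (ψ x)

/-- `∑_{ξ∈Γ*_N\{0}} |f̂(ξ)|²/|ξ|²`. -/
def dualSum (N : ℕ) (f : V3 → ℝ) : ℝ :=
  ∑' k : Fin 3 → ℤ, if k = 0 then 0 else
    Complex.normSq (fCoeffR N f (xiN N k)) / nsqV (xiN N k)

/-- The energy functional `E(ψ,q,p)`. -/
def energyE (N : ℕ) (σ : V3 → ℝ) (e M : ℝ) (ψ : V3 → ℂ) (q p : GammaIdx N → V3) : ℝ :=
  (1 / 2) * (∫ x in cubeN N, gradSq ψ x)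
    + (2 * (N : ℝ) ^ 3)⁻¹ * dualSum N (rhoT N σ e ψ q)
    + (2 * M)⁻¹ * ∑ n : GammaIdx N, nsqV (p n)

/-- The matrix `Σ(θ) = ∑_{m∈ℤ³} (ξξᵀ/|ξ|²)|σ̂(ξ)|²`, `ξ = θ + 2πm`. -/
def SigMat (N : ℕ) (σ : V3 → ℝ) (θ : V3) : Matrix (Fin 3) (Fin 3) ℝ :=
  Matrix.of fun a b => ∑' m : Fin 3 → ℤ,
    ((θ a + 2 * π * (m a : ℝ)) * (θ b + 2 * π * (m b : ℝ))
        / nsqV (fun i => θ i + 2 * π * (m i : ℝ)))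
      * Complex.normSq (fCoeffR N σ (fun i => θ i + 2 * π * (m i : ℝ)))

/-- The Wiener condition: `Σ(θ)` is positive definite for all `θ ∈ Γ*_N \ Γ*_1`. -/
def WienerCond (N : ℕ) (σ : V3 → ℝ) : Prop :=
  ∀ k : Fin 3 → ℤ, ¬ inGamma1 N k → (SigMat N σ (xiN N k)).PosDef

/-- First-order ionic density `σ⁽¹⁾(x) = −∑_n κ(n)·∇σ(x−n−r)`. -/
def sigma1F (N : ℕ) (σ : V3 → ℝ) (r : V3) (κ : GammaIdx N → V3) (x : V3) : ℝ :=
  - ∑ n : GammaIdx N, dotP (κ n) (gradV σ (x - embG n - r))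

/-- First-order charge density `ρ⁽¹⁾(x) = σ⁽¹⁾(x) − 2e√Z·Re(e^{−iα}φ(x))`. -/
def rho1F (N : ℕ) (σ : V3 → ℝ) (e Z α : ℝ) (r : V3) (κ : GammaIdx N → V3)
    (φ : V3 → ℂ) (x : V3) : ℝ :=
  sigma1F N σ r κ x - 2 * e * Real.sqrt Z * (Complex.exp (-Complex.I * (α : ℂ)) * φ x).re

/-- The quadratic form `B(φ,κ,p)` (half of the energy Hessian). -/
def BformQ (N : ℕ) (σ : V3 → ℝ) (e Z M α : ℝ) (r : V3)
    (φ : V3 → ℂ) (κ p : GammaIdx N → V3) : ℝ :=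
  (1 / 2) * (∫ x in cubeN N, gradSq φ x)
    + (2 * (N : ℝ) ^ 3)⁻¹ * dualSum N (rho1F N σ e Z α r κ φ)
    + (2 * M)⁻¹ * ∑ n : GammaIdx N, nsqV (p n)

/-- Second-order charge density `ρ⁽²⁾`. -/
def rho2F (N : ℕ) (σ : V3 → ℝ) (e : ℝ) (r : V3) (κ : GammaIdx N → V3)
    (φ : V3 → ℂ) (x : V3) : ℝ :=
  (∑ n : GammaIdx N,
      (σ (x - embG n - r - κ n) - σ (x - embG n - r)
        + dotP (κ n) (gradV σ (x - embG n - r))))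
    - e * Complex.normSq (φ x)

/-- The pairing `(f, Gg) = N⁻³ ∑_{ξ∈Γ*_N\{0}} Re(f̂(ξ)·conj(ĝ(ξ)))/|ξ|²`. -/
def GPair (N : ℕ) (f g : V3 → ℝ) : ℝ :=
  ((N : ℝ) ^ 3)⁻¹ * ∑' k : Fin 3 → ℤ, if k = 0 then 0 else
    (fCoeffR N f (xiN N k) * (starRingEnd ℂ) (fCoeffR N g (xiN N k))).re / nsqV (xiN N k)

/-- The distance to the solitary manifold of ground states. -/
def distS (N : ℕ) (Z : ℝ) (ψ : V3 → ℂ) (q p : GammaIdx N → V3) : ℝ :=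
  ⨅ (α : ℝ) (r : V3),
    (Real.sqrt (∫ x in cubeN N,
        (Complex.normSq (ψ x - Complex.exp (Complex.I * (α : ℂ)) * ((Real.sqrt Z : ℝ) : ℂ))
          + gradSq ψ x))
      + Real.sqrt (∑ n : GammaIdx N, ⨅ k : Fin 3 → ℤ,
          nsqV (fun i => q n i - r i - (N : ℝ) * (k i : ℝ)))
      + Real.sqrt (∑ n : GammaIdx N, nsqV (p n)))

/-- The discrete Fourier transform `κ̂(θ) ∈ ℂ³` of `κ : Γ_N → ℝ³`. -/
def hatK (N : ℕ) (κ : GammaIdx N → V3) (θ : V3) (a : Fin 3) : ℂ :=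
  ∑ n : GammaIdx N, Complex.exp (Complex.I * ((dotP θ (embG n) : ℝ) : ℂ)) * ((κ n a : ℝ) : ℂ)

/-- Laplacian of a complex-valued function on `ℝ³`. -/
def lapC (f : V3 → ℂ) (x : V3) : ℂ :=
  ∑ i, fderiv ℝ (fun y => fderiv ℝ f y (Pi.single i 1)) x (Pi.single i 1)

/-- Laplacian of a real-valued function on `ℝ³`. -/
def lapR (f : V3 → ℝ) (x : V3) : ℝ :=
  ∑ i, fderiv ℝ (fun y => fderiv ℝ f y (Pi.single i 1)) x (Pi.single i 1)

/-- A classical solution of the Schrödinger–Poisson–Newton system on `ℝ`. -/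
structure IsSPN (N : ℕ) (σ : V3 → ℝ) (e M : ℝ)
    (ψ : V3 → ℝ → ℂ) (Φ : V3 → ℝ → ℝ) (q : ℝ → GammaIdx N → V3) : Prop where
  per_psi : ∀ t : ℝ, IsPerN N (fun x => ψ x t)
  per_Phi : ∀ t : ℝ, IsPerN N (fun x => Φ x t)
  regx_psi : ∀ t : ℝ, ContDiff ℝ 2 (fun x => ψ x t)
  regt_psi : ∀ x : V3, ContDiff ℝ 1 (fun t => ψ x t)
  regx_Phi : ∀ t : ℝ, ContDiff ℝ 2 (fun x => Φ x t)
  regt_Phi : ∀ x : V3, ContDiff ℝ 1 (fun t => Φ x t)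
  reg_q : ContDiff ℝ 2 q
  schrodinger : ∀ (x : V3) (t : ℝ),
    Complex.I * deriv (fun s => ψ x s) t =
      -(1 / 2 : ℂ) * lapC (fun y => ψ y t) x - ((e : ℝ) : ℂ) * ((Φ x t : ℝ) : ℂ) * ψ x t
  poisson : ∀ (x : V3) (t : ℝ),
    - lapR (fun y => Φ y t) x =
      (∑ n : GammaIdx N, σ (x - embG n - q t n)) - e * Complex.normSq (ψ x t)
  newton : ∀ (n : GammaIdx N) (t : ℝ) (i : Fin 3),
    M * deriv (fun s => deriv (fun u => q u n i) s) t =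
      - ∫ x in cubeN N, fderiv ℝ (fun y => Φ y t) x (Pi.single i 1) * σ (x - embG n - q t n)

section helpers

open scoped Pointwise

lemma cubeN_meas (N : ℕ) : MeasurableSet (cubeN N) := by
  have : cubeN N = Set.pi Set.univ (fun _ : Fin 3 => Set.Ico (0:ℝ) N) := by
    ext x; simp [cubeN]
  rw [this]
  exact MeasurableSet.univ_pi (fun i => measurableSet_Ico)

lemma cubeN_vol (N : ℕ) : volume.real (cubeN N) = (N:ℝ)^3 := by
  have : cubeN N = Set.pi Set.univ (fun _ : Fin 3 => Set.Ico (0:ℝ) N) := by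
    ext x; simp [cubeN]
  rw [this, measureReal_def, Real.volume_pi_Ico_toReal]
  · simp
  · intro i; simp

lemma cubeN_sub (N : ℕ) : cubeN N ⊆ Set.Icc (0 : V3) (fun _ => (N:ℝ)) := by
  intro x hx
  exact ⟨fun i => (hx i).1, fun i => (hx i).2.le⟩

instance cubeN_fin (N : ℕ) : IsFiniteMeasure (volume.restrict (cubeN N)) := by
  constructor
  rw [Measure.restrict_apply_univ]
  exact lt_of_le_of_lt (measure_mono (cubeN_sub N)) (isCompact_Icc.measure_lt_top)

lemma cubeN_real_univ (N : ℕ) : (volume.restrict (cubeN N)).real Set.univ = (N:ℝ)^3 := by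
  rw [measureReal_restrict_apply_univ, cubeN_vol]

lemma cont_int {E : Type*} [NormedAddCommGroup E] (N : ℕ) {f : V3 → E} (hf : Continuous f) :
    IntegrableOn f (cubeN N) :=
  (hf.continuousOn.integrableOn_compact isCompact_Icc).mono_set (cubeN_sub N)

/-- basis of the lattice N ℤ³ -/
def basN (N : ℕ) (hN : 0 < N) : Module.Basis (Fin 3) ℝ V3 :=
  (Pi.basisFun ℝ (Fin 3)).isUnitSMul (w := fun _ => (N:ℝ))
    (fun _ => (isUnit_iff_ne_zero.2 (by positivity)))

lemma basN_apply (N : ℕ) (hN : 0 < N) (i : Fin 3) : basN N hN i = (N:ℝ) • Pi.single i (1:ℝ) := by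
  simp [basN, Module.Basis.isUnitSMul_apply]

lemma cubeN_fd (N : ℕ) (hN : 0 < N) : cubeN N = ZSpan.fundamentalDomain (basN N hN) := by
  ext x
  have hN' : (0:ℝ) < N := by positivity
  have hx : ∀ i, (basN N hN).repr x i = x i / N := by
    intro i
    have h2 : x = ∑ j, (x j / N) • basN N hN j := by
      ext j
      simp [basN_apply, Finset.sum_apply, Pi.single_apply]
      field_simp
    conv_lhs => rw [h2]
    rw [Module.Basis.repr_sum_self]
  simp only [cubeN, ZSpan.fundamentalDomain, Set.mem_ofPred_eq, hx, Set.mem_Ico]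
  apply forall_congr'
  intro i
  rw [div_lt_one hN', le_div_iff₀ hN', zero_mul]

lemma per_translate {E : Type*} [NormedAddCommGroup E] [NormedSpace ℝ E] {N : ℕ} (hN : 0 < N)
    {f : V3 → E} (hf : IsPerN N f) (h : V3) :
    ∫ x in cubeN N, f (x + h) = ∫ x in cubeN N, f x := by
  have hfd := ZSpan.isAddFundamentalDomain' (basN N hN) (volume : Measure V3)
  rw [← cubeN_fd] at hfd
  have hfd2 := hfd.vadd_of_comm h
  have hinv : ∀ (g : (Submodule.span ℤ (Set.range (basN N hN))).toAddSubgroup) (x : V3), f (g +ᵥ x) = f x := by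
    rintro ⟨g, hg⟩ x
    have : ∃ k : Fin 3 → ℤ, g = fun i => (N:ℝ) * k i := by
      refine Submodule.span_induction (p := fun g _ => ∃ k : Fin 3 → ℤ, g = fun i => (N:ℝ) * k i)
        ?_ ?_ ?_ ?_ hg
      · rintro _ ⟨j, rfl⟩
        refine ⟨Pi.single j 1, ?_⟩
        ext i
        rw [basN_apply]
        by_cases hij : i = j
        · subst hij; simp
        · simp [hij]
      · exact ⟨0, by ext; simp⟩
      · rintro _ _ _ _ ⟨a, rfl⟩ ⟨b, rfl⟩
        exact ⟨a + b, by ext; simp; ring⟩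
      · rintro c _ _ ⟨a, rfl⟩
        exact ⟨c • a, by ext; simp; ring⟩
    obtain ⟨k, rfl⟩ := this
    have := hf x k
    rw [AddSubgroup.vadd_def]
    simp only [vadd_eq_add]
    rw [add_comm, this]
  haveI : Countable (Submodule.span ℤ (Set.range (basN N hN))).toAddSubgroup :=
    inferInstanceAs (Countable (Submodule.span ℤ (Set.range (basN N hN))))
  have key := hfd.setIntegral_eq hfd2 hinv
  rw [key]
  have hmp : MeasurePreserving (fun x : V3 => x + h) volume volume :=
    measurePreserving_add_right volume h
  have hme : MeasurableEmbedding (fun x : V3 => x + h) := measurableEmbedding_addRight h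
  have := hmp.setIntegral_preimage_emb hme f (h +ᵥ cubeN N)
  rw [← this]
  congr 2
  ext x
  simp only [Set.mem_preimage]
  rw [Set.mem_vadd_set_iff_neg_vadd_mem]
  simp [add_comm]

/-- Cauchy–Schwarz for real integrals. -/
lemma cs_int {X : Type*} [MeasurableSpace X] {μ : Measure X} {u v : X → ℝ}
    (hu : Integrable (fun x => u x ^ 2) μ) (hv : Integrable (fun x => v x ^ 2) μ)
    (huv : Integrable (fun x => u x * v x) μ) :
    (∫ x, u x * v x ∂μ) ^ 2 ≤ (∫ x, u x ^ 2 ∂μ) * ∫ x, v x ^ 2 ∂μ := by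
  have h : ∀ t : ℝ, 0 ≤ (∫ x, v x ^ 2 ∂μ) * (t * t) + (2 * ∫ x, u x * v x ∂μ) * t
      + ∫ x, u x ^ 2 ∂μ := by
    intro t
    have h0 : 0 ≤ ∫ x, (v x ^ 2 * (t * t) + (u x * v x) * (2 * t) + u x ^ 2) ∂μ := by
      apply integral_nonneg
      intro x
      have := sq_nonneg (u x + t * v x)
      simp only [Pi.zero_apply]
      nlinarith
    rw [integral_add (by exact (hv.mul_const _).add (huv.mul_const _)) hu,
      integral_add (hv.mul_const _) (huv.mul_const _), integral_mul_const, integral_mul_const] at h0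
    linarith
  have := discrim_le_zero h
  unfold discrim at this
  nlinarith

lemma cs_const {X E : Type*} [MeasurableSpace X] [NormedAddCommGroup E] [NormedSpace ℝ E]
    {μ : Measure X} [IsFiniteMeasure μ]
    {u : X → E} (hu1 : Integrable u μ) (hu : Integrable (fun x => ‖u x‖ ^ 2) μ) :
    ‖∫ x, u x ∂μ‖ ^ 2 ≤ μ.real Set.univ * ∫ x, ‖u x‖ ^ 2 ∂μ := by
  have h1 := cs_int (μ := μ) (u := fun x => ‖u x‖) (v := fun _ => 1) hu
    (by simp) (by simpa using hu1.norm)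
  simp only [mul_one, one_pow, integral_const, smul_eq_mul] at h1
  have h2 := norm_integral_le_integral_norm (μ := μ) u
  have h3 := norm_nonneg (∫ x, u x ∂μ)
  calc ‖∫ x, u x ∂μ‖ ^ 2 ≤ (∫ x, ‖u x‖ ∂μ)^2 := by gcongr
    _ ≤ _ := by linarith


lemma nsqV_nonneg (v : V3) : 0 ≤ nsqV v := Finset.sum_nonneg fun _ _ => sq_nonneg _

lemma gradSq_nonneg (f : V3 → ℂ) (x : V3) : 0 ≤ gradSq f x :=
  Finset.sum_nonneg fun _ _ => Complex.normSq_nonneg _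

lemma fderiv_sq_le (f : V3 → ℂ) (y h : V3) :
    ‖fderiv ℝ f y h‖ ^ 2 ≤ nsqV h * gradSq f y := by
  have hh : h = ∑ i, h i • (Pi.single i 1 : V3) := by
    ext j; simp [Finset.sum_apply, Pi.single_apply]
  have h1 : ‖fderiv ℝ f y h‖ ≤ ∑ i, |h i| * ‖fderiv ℝ f y (Pi.single i 1)‖ := by
    conv_lhs => rw [hh]
    rw [map_sum]
    refine (norm_sum_le _ _).trans (le_of_eq ?_)
    apply Finset.sum_congr rfl
    intro i _
    rw [map_smul, norm_smul, Real.norm_eq_abs]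
  calc ‖fderiv ℝ f y h‖ ^ 2 ≤ (∑ i, |h i| * ‖fderiv ℝ f y (Pi.single i 1)‖) ^ 2 := by gcongr
    _ ≤ (∑ i, |h i| ^ 2) * ∑ i, ‖fderiv ℝ f y (Pi.single i 1)‖ ^ 2 :=
      Finset.sum_mul_sq_le_sq_mul_sq _ _ _
    _ = _ := by simp [nsqV, gradSq, Complex.normSq_eq_norm_sq]

lemma gradSq_cont {f : V3 → ℂ} (hf : ContDiff ℝ 1 f) : Continuous (gradSq f) := by
  have h := hf.continuous_fderiv (by norm_num)
  unfold gradSq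
  refine continuous_finsetSum _ fun i _ => Complex.continuous_normSq.comp ?_
  exact h.clm_apply continuous_const

lemma fderiv_per {N : ℕ} {f : V3 → ℂ} (hf : IsPerN N f) : IsPerN N (fderiv ℝ f) := by
  intro x k
  have : (fun y => f (y + fun i => (N : ℝ) * (k i : ℝ))) = f := by
    ext y; exact hf y k
  rw [← fderiv_comp_add_right, this]

lemma gradSq_per {N : ℕ} {f : V3 → ℂ} (hf : IsPerN N f) : IsPerN N (gradSq f) := by
  intro x k
  have := fderiv_per hf x k
  simp only [gradSq, this]

lemma ptw_diff {f : V3 → ℂ} (hf : ContDiff ℝ 1 f) (x h : V3) :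
    ‖f (x + h) - f x‖ ^ 2 ≤ nsqV h * ∫ t in Set.Icc (0:ℝ) 1, gradSq f (x + t • h) := by
  have hd : ∀ t ∈ Set.uIcc (0:ℝ) 1, HasDerivAt (fun t : ℝ => f (x + t • h))
      (fderiv ℝ f (x + t • h) h) t := by
    intro t _
    have h1 : HasFDerivAt f (fderiv ℝ f (x + t • h)) (x + t • h) :=
      ((hf.differentiable (by norm_num)) _).hasFDerivAt
    have h2 : HasDerivAt (fun t : ℝ => x + t • h) h t := by
      simpa using ((hasDerivAt_id t).smul_const h).const_add x
    exact h1.comp_hasDerivAt t h2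
  have hc : Continuous (fun t : ℝ => fderiv ℝ f (x + t • h) h) := by
    have h := hf.continuous_fderiv (by norm_num)
    fun_prop
  have hi := intervalIntegral.integral_eq_sub_of_hasDerivAt hd (hc.intervalIntegrable _ _)
  rw [intervalIntegral.integral_of_le zero_le_one, ← integral_Icc_eq_integral_Ioc] at hi
  simp only [one_smul, zero_smul, add_zero] at hi
  rw [← hi]
  have hcg := gradSq_cont hf
  have hcs := cs_const (μ := volume.restrict (Set.Icc (0:ℝ) 1))
    (u := fun t : ℝ => fderiv ℝ f (x + t • h) h)
    (hc.continuousOn.integrableOn_compact isCompact_Icc)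
    ((by fun_prop : Continuous fun t : ℝ => ‖fderiv ℝ f (x + t • h) h‖^2).continuousOn.integrableOn_compact isCompact_Icc)
  simp only [measureReal_restrict_apply_univ, Real.volume_real_Icc, sub_zero, zero_le_one,
    sup_of_le_left, one_mul] at hcs
  refine hcs.trans ?_
  rw [← integral_const_mul]
  apply integral_mono
  · exact ((by fun_prop : Continuous fun t : ℝ => ‖fderiv ℝ f (x + t • h) h‖^2).continuousOn.integrableOn_compact isCompact_Icc)
  · exact ((by fun_prop : Continuous fun t : ℝ => nsqV h * gradSq f (x + t • h)).continuousOn.integrableOn_compact isCompact_Icc)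
  · intro t
    exact fderiv_sq_le f _ h

lemma diff_L2 {N : ℕ} (hN : 0 < N) {f : V3 → ℂ} (hf : ContDiff ℝ 1 f) (hp : IsPerN N f) (h : V3) :
    ∫ x in cubeN N, ‖f (x + h) - f x‖ ^ 2 ≤ nsqV h * ∫ x in cubeN N, gradSq f x := by
  have hcg := gradSq_cont hf
  have hcf := hf.continuous
  have hprod : Integrable (Function.uncurry fun (x : V3) (t : ℝ) => gradSq f (x + t • h))
      ((volume.restrict (cubeN N)).prod (volume.restrict (Set.Icc (0:ℝ) 1))) := by
    rw [Measure.prod_restrict]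
    have hc : Continuous (Function.uncurry fun (x : V3) (t : ℝ) => gradSq f (x + t • h)) := by
      unfold Function.uncurry
      fun_prop
    have : IntegrableOn (Function.uncurry fun (x : V3) (t : ℝ) => gradSq f (x + t • h))
      (Set.Icc (0 : V3) (fun _ => (N:ℝ)) ×ˢ Set.Icc (0:ℝ) 1) (volume.prod volume) :=
      hc.continuousOn.integrableOn_compact (isCompact_Icc.prod isCompact_Icc)
    exact this.mono_set (Set.prod_mono (cubeN_sub N) le_rfl)
  calc ∫ x in cubeN N, ‖f (x + h) - f x‖ ^ 2
      ≤ ∫ x in cubeN N, nsqV h * ∫ t in Set.Icc (0:ℝ) 1, gradSq f (x + t • h) := by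
        apply integral_mono
        · exact cont_int N (by fun_prop)
        · exact hprod.integral_prod_left.const_mul _
        · intro x; exact ptw_diff hf x h
    _ = nsqV h * ∫ x in cubeN N, ∫ t in Set.Icc (0:ℝ) 1, gradSq f (x + t • h) := by
        rw [integral_const_mul]
    _ = nsqV h * ∫ t in Set.Icc (0:ℝ) 1, ∫ x in cubeN N, gradSq f (x + t • h) := by
        rw [integral_integral_swap hprod]
    _ = nsqV h * ∫ t in Set.Icc (0:ℝ) 1, ∫ x in cubeN N, gradSq f x := by
        simp_rw [per_translate hN (gradSq_per hp)]
    _ = _ := by simp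

lemma poincare {N : ℕ} (hN : 0 < N) {f : V3 → ℂ} (hf : ContDiff ℝ 1 f) (hp : IsPerN N f) :
    ∫ x in cubeN N, ‖f x - ((N:ℝ)^3)⁻¹ • ∫ y in cubeN N, f y‖ ^ 2
      ≤ 3 * (N:ℝ)^2 * ∫ x in cubeN N, gradSq f x := by
  set G := ∫ x in cubeN N, gradSq f x with hG
  have hG0 : 0 ≤ G := integral_nonneg fun x => gradSq_nonneg f x
  have hcf := hf.continuous
  have hN0 : (0:ℝ) < (N:ℝ)^3 := by positivity
  have hprod : Integrable (Function.uncurry fun (x : V3) (h : V3) => ‖f (x + h) - f x‖ ^ 2)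
      ((volume.restrict (cubeN N)).prod (volume.restrict (cubeN N))) := by
    rw [Measure.prod_restrict]
    have hc : Continuous (Function.uncurry fun (x : V3) (h : V3) => ‖f (x + h) - f x‖ ^ 2) := by
      unfold Function.uncurry
      fun_prop
    have : IntegrableOn (Function.uncurry fun (x : V3) (h : V3) => ‖f (x + h) - f x‖ ^ 2)
      (Set.Icc (0 : V3) (fun _ => (N:ℝ)) ×ˢ Set.Icc (0 : V3) (fun _ => (N:ℝ)))
        (volume.prod volume) :=
      hc.continuousOn.integrableOn_compact (isCompact_Icc.prod isCompact_Icc)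
    exact this.mono_set (Set.prod_mono (cubeN_sub N) (cubeN_sub N))
  have hpt : ∀ x, ‖f x - ((N:ℝ)^3)⁻¹ • ∫ y in cubeN N, f y‖ ^ 2
      ≤ ((N:ℝ)^3)⁻¹ * ∫ h in cubeN N, ‖f (x + h) - f x‖ ^ 2 := by
    intro x
    have h1 : ∫ h in cubeN N, (f (x + h) - f x) = (∫ y in cubeN N, f y) - (N:ℝ)^3 • f x := by
      rw [integral_sub (cont_int N (by fun_prop)) (cont_int N (by fun_prop)), integral_const,
        cubeN_real_univ]
      congr 1
      simp_rw [add_comm x]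
      exact per_translate hN hp x
    have h2 : f x - ((N:ℝ)^3)⁻¹ • ∫ y in cubeN N, f y
        = -(((N:ℝ)^3)⁻¹ • ∫ h in cubeN N, (f (x + h) - f x)) := by
      rw [h1, smul_sub, smul_smul, inv_mul_cancel₀ hN0.ne']
      simp
    rw [h2, norm_neg, norm_smul, mul_pow]
    have h3 := cs_const (μ := volume.restrict (cubeN N)) (u := fun h => f (x + h) - f x)
      (cont_int N (by fun_prop)) (cont_int N (by fun_prop))
    rw [cubeN_real_univ] at h3
    calc _ ≤ ‖((N:ℝ)^3)⁻¹‖^2 * ((N:ℝ)^3 * ∫ h in cubeN N, ‖f (x + h) - f x‖ ^ 2) := by gcongr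
      _ = _ := by
        rw [Real.norm_of_nonneg (by positivity)]
        field_simp
  calc _ ≤ ∫ x in cubeN N, ((N:ℝ)^3)⁻¹ * ∫ h in cubeN N, ‖f (x + h) - f x‖ ^ 2 := by
        apply integral_mono
        · exact cont_int N (by fun_prop)
        · exact hprod.integral_prod_left.const_mul _
        · exact hpt
    _ = ((N:ℝ)^3)⁻¹ * ∫ h in cubeN N, ∫ x in cubeN N, ‖f (x + h) - f x‖ ^ 2 := by
        rw [integral_const_mul, integral_integral_swap hprod]
    _ ≤ ((N:ℝ)^3)⁻¹ * ∫ h in cubeN N, 3 * (N:ℝ)^2 * G := by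
        refine mul_le_mul_of_nonneg_left ?_ (by positivity)
        apply setIntegral_mono_on
        · exact hprod.integral_prod_right
        · exact cont_int N continuous_const
        · exact cubeN_meas N
        · intro h hh
          refine (diff_L2 hN hf hp h).trans ?_
          gcongr
          have : ∀ i, h i ^ 2 ≤ (N:ℝ)^2 := fun i => by
            have := hh i
            have h1 := this.1
            have h2 := this.2
            gcongr
          simp only [nsqV, Fin.sum_univ_three]
          linarith [this 0, this 1, this 2]
    _ = _ := by
        rw [integral_const, cubeN_real_univ, smul_eq_mul]
        field_simp


lemma dotP_add (u v w : V3) : dotP u (v + w) = dotP u v + dotP u w := by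
  simp [dotP, mul_add, Finset.sum_add_distrib]

lemma dotP_sub (u v w : V3) : dotP u (v - w) = dotP u v - dotP u w := by
  simp [dotP, mul_sub, Finset.sum_sub_distrib]

lemma dotP_cont (u : V3) : Continuous (dotP u) := by
  unfold dotP; fun_prop

lemma exp_lattice {N : ℕ} (hN : 0 < N) (k m : Fin 3 → ℤ) :
    Complex.exp (Complex.I * ((dotP (xiN N k) (fun i => (N:ℝ) * (m i : ℝ)) : ℝ) : ℂ)) = 1 := by
  have hN' : (N:ℂ) ≠ 0 := by exact_mod_cast hN.ne'
  have : Complex.I * ((dotP (xiN N k) (fun i => (N:ℝ) * (m i : ℝ)) : ℝ) : ℂ)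
      = ((∑ i, k i * m i : ℤ) : ℂ) * (2 * π * Complex.I) := by
    simp only [dotP, xiN, Fin.sum_univ_three]
    push_cast
    field_simp
  rw [this, Complex.exp_int_mul_two_pi_mul_I]

lemma exp_split (u v w : V3) : Complex.exp (Complex.I * ((dotP u (v + w) : ℝ) : ℂ))
    = Complex.exp (Complex.I * ((dotP u v : ℝ) : ℂ)) * Complex.exp (Complex.I * ((dotP u w : ℝ) : ℂ)) := by
  rw [dotP_add, ← Complex.exp_add]; push_cast; ring_nf

lemma norm_exp_dot (t : ℝ) : ‖Complex.exp (Complex.I * (t : ℂ))‖ = 1 := by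
  rw [mul_comm]; exact Complex.norm_exp_ofReal_mul_I t

lemma exp_mul_per {N : ℕ} (hN : 0 < N) (k : Fin 3 → ℤ) {f : V3 → ℂ} (hf : IsPerN N f) :
    IsPerN N (fun x => Complex.exp (Complex.I * ((dotP (xiN N k) x : ℝ) : ℂ)) * f x) := by
  intro x m
  simp only
  rw [hf x m, exp_split, exp_lattice hN, mul_one]

lemma fCoeff_shift {N : ℕ} (hN : 0 < N) (k : Fin 3 → ℤ) {f : V3 → ℂ} (hf : IsPerN N f) (s : V3) :
    fCoeff N (fun x => f (x - s)) (xiN N k)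
      = Complex.exp (Complex.I * ((dotP (xiN N k) s : ℝ) : ℂ)) * fCoeff N f (xiN N k) := by
  have hf' : IsPerN N (fun x => f (x - s)) := by
    intro x m
    have := hf (x - s) m
    simp only
    rw [← this]; congr 1; abel
  have := per_translate hN (exp_mul_per hN k hf') s
  unfold fCoeff
  rw [← this, ← integral_const_mul]
  congr 1
  ext x
  rw [exp_split, add_sub_cancel_right]
  ring

lemma fCoeff_half {N : ℕ} (hN : 0 < N) (k : Fin 3 → ℤ) {f : V3 → ℂ} (hf : IsPerN N f)
    (hc : Continuous f) (h : V3) (hh : dotP (xiN N k) h = π) :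
    2 * ‖fCoeff N f (xiN N k)‖ ≤ ∫ x in cubeN N, ‖f (x + h) - f x‖ := by
  have hd := dotP_cont (xiN N k)
  have h1 : fCoeff N (fun x => f (x - (-h))) (xiN N k) = - fCoeff N f (xiN N k) := by
    rw [fCoeff_shift hN k hf]
    have : dotP (xiN N k) (-h) = -π := by rw [← hh]; simp [dotP]
    rw [this]
    have : Complex.I * ((-π : ℝ) : ℂ) = -(π * Complex.I) := by push_cast; ring
    rw [this, Complex.exp_neg, Complex.exp_pi_mul_I]
    norm_num
  have h2 : ∫ x in cubeN N, Complex.exp (Complex.I * ((dotP (xiN N k) x : ℝ) : ℂ)) * (f (x + h) - f x)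
      = -(2 * fCoeff N f (xiN N k)) := by
    simp_rw [mul_sub]
    rw [integral_sub (cont_int N (by fun_prop)) (cont_int N (by fun_prop))]
    simp only [sub_neg_eq_add] at h1
    unfold fCoeff at h1 ⊢
    rw [h1]; ring
  have h3 : 2 * ‖fCoeff N f (xiN N k)‖ = ‖-(2 * fCoeff N f (xiN N k))‖ := by
    rw [norm_neg, norm_mul]; simp
  rw [h3, ← h2]
  refine (norm_integral_le_integral_norm _).trans (le_of_eq ?_)
  simp

lemma nsqV_xi_pos {N : ℕ} (hN : 0 < N) {k : Fin 3 → ℤ} (hk : k ≠ 0) : 0 < nsqV (xiN N k) := by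
  obtain ⟨i, hi⟩ := Function.ne_iff.1 hk
  refine Finset.sum_pos' (fun _ _ => sq_nonneg _) ⟨i, Finset.mem_univ _, ?_⟩
  have : ((k i : ℤ) : ℝ) ≠ 0 := by exact_mod_cast hi
  unfold xiN
  positivity

lemma dotP_smul_self (c : ℝ) (v : V3) : dotP v (fun i => c * v i) = c * nsqV v := by
  simp only [dotP, nsqV, Finset.mul_sum]
  exact Finset.sum_congr rfl fun i _ => by ring

lemma nsqV_smul (c : ℝ) (v : V3) : nsqV (fun i => c * v i) = c ^ 2 * nsqV v := by
  simp only [nsqV, Finset.mul_sum]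
  exact Finset.sum_congr rfl fun i _ => by ring

lemma exists_h {N : ℕ} (hN : 0 < N) {k : Fin 3 → ℤ} (hk : k ≠ 0) :
    ∃ h : V3, dotP (xiN N k) h = π ∧ nsqV h = π ^ 2 / nsqV (xiN N k) := by
  have hp := nsqV_xi_pos hN hk
  refine ⟨fun i => π / nsqV (xiN N k) * xiN N k i, ?_, ?_⟩
  · rw [dotP_smul_self]; field_simp
  · rw [nsqV_smul]; field_simp

lemma fCoeff_decay {N : ℕ} (hN : 0 < N) {k : Fin 3 → ℤ} (hk : k ≠ 0) {f : V3 → ℂ}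
    (hf : IsPerN N f) (hc : ContDiff ℝ 1 f) :
    4 * ‖fCoeff N f (xiN N k)‖ ^ 2
      ≤ (N:ℝ)^3 * (π ^ 2 / nsqV (xiN N k) * ∫ x in cubeN N, gradSq f x) := by
  obtain ⟨h, h1, h2⟩ := exists_h hN hk
  have hcf := hc.continuous
  have h3 := fCoeff_half hN k hf hc.continuous h h1
  have h4 := cs_const (μ := volume.restrict (cubeN N)) (u := fun x => ‖f (x + h) - f x‖)
      (cont_int N (by fun_prop)) (cont_int N (by fun_prop))
  have h5 := diff_L2 hN hc hf h
  rw [cubeN_real_univ] at h4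
  simp only [norm_norm] at h4
  rw [Real.norm_of_nonneg (integral_nonneg fun _ => norm_nonneg _)] at h4
  rw [h2] at h5
  calc _ = (2 * ‖fCoeff N f (xiN N k)‖)^2 := by ring
    _ ≤ (∫ x in cubeN N, ‖f (x + h) - f x‖)^2 := by gcongr
    _ ≤ _ := h4.trans (by gcongr)

lemma normSq_coeff {N : ℕ} (hN : 0 < N) {k : Fin 3 → ℤ} (hk : k ≠ 0) {f : V3 → ℂ}
    (hf : IsPerN N f) (hc : ContDiff ℝ 1 f) :
    ‖fCoeffR N (fun x => Complex.normSq (f x)) (xiN N k)‖ ^ 2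
      ≤ (π ^ 2 / nsqV (xiN N k) * ∫ x in cubeN N, gradSq f x)
        * ∫ x in cubeN N, Complex.normSq (f x) := by
  obtain ⟨h, h1, h2⟩ := exists_h hN hk
  have hcf := hc.continuous
  have hcn : Continuous (fun x => ((Complex.normSq (f x) : ℝ) : ℂ)) :=
    Complex.continuous_ofReal.comp (Complex.continuous_normSq.comp hcf)
  have h3 := fCoeff_half hN k (f := fun x => ((Complex.normSq (f x) : ℝ) : ℂ))
    (by intro x m; simp only [hf x m]) hcn h h1
  have h5 := diff_L2 hN hc hf h
  rw [h2] at h5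
  have hpt : ∀ x, ‖((Complex.normSq (f (x + h)) : ℝ) : ℂ) - ((Complex.normSq (f x) : ℝ) : ℂ)‖
      ≤ ‖f (x + h) - f x‖ * (‖f (x + h)‖ + ‖f x‖) := by
    intro x
    rw [← Complex.ofReal_sub, Complex.norm_real, Complex.normSq_eq_norm_sq,
      Complex.normSq_eq_norm_sq, sq_sub_sq, norm_mul, mul_comm]
    gcongr
    · exact abs_norm_sub_norm_le _ _
    · rw [Real.norm_of_nonneg (by positivity)]
  have h6 : ∫ x in cubeN N, ‖((Complex.normSq (f (x + h)) : ℝ) : ℂ) - ((Complex.normSq (f x) : ℝ) : ℂ)‖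
      ≤ ∫ x in cubeN N, ‖f (x + h) - f x‖ * (‖f (x + h)‖ + ‖f x‖) := by
    apply integral_mono
    · exact cont_int N (((hcn.comp (by fun_prop : Continuous fun x => x + h)).sub hcn).norm)
    · exact cont_int N (by fun_prop)
    · exact hpt
  have h7 := cs_int (μ := volume.restrict (cubeN N)) (u := fun x => ‖f (x + h) - f x‖)
    (v := fun x => ‖f (x + h)‖ + ‖f x‖)
    (cont_int N (by fun_prop)) (cont_int N (by fun_prop)) (cont_int N (by fun_prop))
  have h8 : ∫ x in cubeN N, (‖f (x + h)‖ + ‖f x‖)^2 ≤ 4 * ∫ x in cubeN N, Complex.normSq (f x) := by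
    have e1 : ∫ x in cubeN N, ‖f (x + h)‖^2 = ∫ x in cubeN N, ‖f x‖^2 :=
      per_translate hN (f := fun x => ‖f x‖^2) (by intro x m; simp only [hf x m]) h
    calc _ ≤ ∫ x in cubeN N, (2 * ‖f (x + h)‖^2 + 2 * ‖f x‖^2) := by
          apply integral_mono
          · exact cont_int N (by fun_prop)
          · exact cont_int N (by fun_prop)
          · intro x
            simp only
            nlinarith [sq_nonneg (‖f (x + h)‖ - ‖f x‖)]
      _ = _ := by
        rw [integral_add (cont_int N (by fun_prop)) (cont_int N (by fun_prop)),
          integral_const_mul, integral_const_mul, e1]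
        simp_rw [Complex.normSq_eq_norm_sq]
        ring
  have h9 : 0 ≤ ∫ x in cubeN N, ‖f (x + h) - f x‖^2 := integral_nonneg fun _ => by positivity
  have h10 : 0 ≤ ∫ x in cubeN N, Complex.normSq (f x) := integral_nonneg fun _ => Complex.normSq_nonneg _
  have : (2 * ‖fCoeffR N (fun x => Complex.normSq (f x)) (xiN N k)‖)^2
      ≤ (π ^ 2 / nsqV (xiN N k) * ∫ x in cubeN N, gradSq f x)
        * (4 * ∫ x in cubeN N, Complex.normSq (f x)) := by
    calc _ ≤ (∫ x in cubeN N, ‖f (x + h) - f x‖ * (‖f (x + h)‖ + ‖f x‖))^2 := by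
          have := h3.trans h6
          unfold fCoeffR
          gcongr
      _ ≤ _ := h7.trans (mul_le_mul h5 h8 (integral_nonneg fun _ => by positivity) (h9.trans h5))
  nlinarith

lemma summable_Z3 : Summable (fun k : Fin 3 → ℤ => (‖(fun i => (k i : ℝ) : V3)‖ ^ 4)⁻¹) := by
  let b := Pi.basisFun ℝ (Fin 3)
  let L := Submodule.span ℤ (Set.range b)
  have hr : Module.finrank ℤ L = 3 := by
    have := ZLattice.rank ℝ L
    rw [this]; simp
  have h := ZLattice.summable_norm_pow_inv L 4 (by rw [hr]; norm_num)
  have hmem : ∀ k : Fin 3 → ℤ, (fun i => (k i : ℝ) : V3) ∈ L := by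
    intro k
    have : (fun i => (k i : ℝ) : V3) = ∑ i, k i • b i := by
      ext j; simp [b, Finset.sum_apply, Pi.single_apply]
    rw [this]
    exact Submodule.sum_mem _ fun i _ => Submodule.smul_mem _ _ (Submodule.subset_span ⟨i, rfl⟩)
  have hinj : Function.Injective (fun k : Fin 3 → ℤ => (⟨_, hmem k⟩ : L)) := by
    intro k l hkl
    have := congrArg Subtype.val hkl
    ext i
    have := congrFun this i
    simpa using this
  have := h.comp_injective hinj
  simpa [Function.comp_def] using this

lemma nsqV_ge_norm (v : V3) : ‖v‖ ^ 2 ≤ nsqV v := by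
  have : ‖v‖ ≤ Real.sqrt (nsqV v) := by
    rw [pi_norm_le_iff_of_nonneg (Real.sqrt_nonneg _)]
    intro i
    apply Real.le_sqrt_of_sq_le
    rw [Real.norm_eq_abs, sq_abs]
    exact Finset.single_le_sum (f := fun i => v i ^ 2) (fun _ _ => sq_nonneg _) (Finset.mem_univ i)
  calc ‖v‖ ^ 2 ≤ (Real.sqrt (nsqV v))^2 := by gcongr
    _ = _ := Real.sq_sqrt (nsqV_nonneg v)

lemma dual_summable {N : ℕ} (hN : 0 < N) {f : V3 → ℝ} (hf : IsPerN N f) (hc : ContDiff ℝ 1 f) :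
    Summable (fun k : Fin 3 → ℤ => if k = 0 then 0 else
    Complex.normSq (fCoeffR N f (xiN N k)) / nsqV (xiN N k)) := by
  set F : V3 → ℂ := fun x => ((f x : ℝ) : ℂ) with hF
  have hFc : ContDiff ℝ 1 F := Complex.ofRealCLM.contDiff.comp hc
  have hFp : IsPerN N F := by intro x m; simp only [hF, hf x m]
  set G := ∫ x in cubeN N, gradSq F x
  have hG : 0 ≤ G := integral_nonneg fun x => gradSq_nonneg F x
  set c : ℝ := (2 * π / N) ^ 2
  have hc0 : 0 < c := by positivity
  refine Summable.of_nonneg_of_le (f := fun k : Fin 3 → ℤ => ((N:ℝ)^3 * π^2 * G / c^2) * (‖(fun i => (k i : ℝ) : V3)‖ ^ 4)⁻¹) ?_ ?_ (summable_Z3.mul_left _)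
  · intro k
    split_ifs
    · exact le_rfl
    · exact div_nonneg (Complex.normSq_nonneg _) (nsqV_nonneg _)
  · intro k
    split_ifs with hk
    · positivity
    · have h1 := fCoeff_decay hN hk hFp hFc
      have h2 := nsqV_xi_pos hN hk
      have h3 : c * ‖(fun i => (k i : ℝ) : V3)‖ ^ 2 ≤ nsqV (xiN N k) := by
        have : nsqV (xiN N k) = c * nsqV (fun i => (k i : ℝ)) := by
          simp only [nsqV, xiN, mul_pow, Finset.mul_sum, c]
        rw [this]
        gcongr
        exact nsqV_ge_norm _
      have h4 : 0 < ‖(fun i => (k i : ℝ) : V3)‖ := by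
        rw [norm_pos_iff]
        intro h
        apply hk
        ext i
        have := congrFun h i
        simpa using this
      set R := ‖(fun i => (k i : ℝ) : V3)‖
      set X := nsqV (xiN N k)
      rw [Complex.normSq_eq_norm_sq]
      change ‖fCoeff N F (xiN N k)‖ ^ 2 / X ≤ _
      have h5 : ‖fCoeff N F (xiN N k)‖ ^ 2 ≤ (N:ℝ)^3 * π^2 * G / X := by
        have e : (N:ℝ)^3 * (π ^ 2 / X * G) = (N:ℝ)^3 * π^2 * G / X := by ring
        have h0 : 0 ≤ ‖fCoeff N F (xiN N k)‖ ^ 2 := by positivity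
        linarith
      calc _ ≤ (N:ℝ)^3 * π^2 * G / X / X := by gcongr
        _ ≤ (N:ℝ)^3 * π^2 * G / (c * R^2) / (c * R^2) := by gcongr
        _ = _ := by field_simp


lemma geom1 {N : ℕ} (hN : 0 < N) (d : ℤ) :
    ∑ j : Fin N, Complex.exp (Complex.I * ((2 * π / (N:ℝ) * (d:ℝ) * ((j : ℕ) : ℝ) : ℝ) : ℂ))
      = if (N:ℤ) ∣ d then (N:ℂ) else 0 := by
  have hN' : (N:ℂ) ≠ 0 := by exact_mod_cast hN.ne'
  set z : ℂ := Complex.exp (Complex.I * ((2 * π / (N:ℝ) * (d:ℝ) : ℝ) : ℂ)) with hz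
  have h1 : ∀ j : ℕ, Complex.exp (Complex.I * ((2 * π / (N:ℝ) * (d:ℝ) * (j : ℝ) : ℝ) : ℂ)) = z ^ j := by
    intro j
    rw [hz, ← Complex.exp_nat_mul]
    congr 1; push_cast; ring
  simp_rw [h1]
  rw [Fin.sum_univ_eq_sum_range (fun j => z ^ j) N]
  split_ifs with hd
  · obtain ⟨c, rfl⟩ := hd
    have : z = 1 := by
      rw [hz]
      have : Complex.I * ((2 * π / (N:ℝ) * (((N:ℤ) * c : ℤ):ℝ) : ℝ) : ℂ) = c * (2 * π * Complex.I) := by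
        push_cast; field_simp
      rw [this, Complex.exp_int_mul_two_pi_mul_I]
    simp [this]
  · have hz1 : z ≠ 1 := by
      intro h
      rw [hz, Complex.exp_eq_one_iff] at h
      obtain ⟨n, hn⟩ := h
      apply hd
      refine ⟨n, ?_⟩
      have hpi : (π:ℂ) ≠ 0 := by exact_mod_cast Real.pi_ne_zero
      have : (d:ℂ) = N * n := by
        push_cast at hn
        field_simp at hn
        linear_combination hn
      exact_mod_cast this
    rw [geom_sum_eq hz1]
    have : z ^ N = 1 := by
      rw [hz, ← Complex.exp_nat_mul]
      have : (N:ℂ) * (Complex.I * ((2 * π / (N:ℝ) * (d:ℝ) : ℝ) : ℂ)) = d * (2 * π * Complex.I) := by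
        push_cast; field_simp
      rw [this, Complex.exp_int_mul_two_pi_mul_I]
    simp [this]

open Classical in
lemma geom3 {N : ℕ} (hN : 0 < N) (k : Fin 3 → ℤ) :
    ∑ n : GammaIdx N, Complex.exp (Complex.I * ((dotP (xiN N k) (embG n) : ℝ) : ℂ))
      = if inGamma1 N k then (N:ℂ)^3 else 0 := by
  have h1 : ∀ n : GammaIdx N, Complex.exp (Complex.I * ((dotP (xiN N k) (embG n) : ℝ) : ℂ))
      = ∏ i, Complex.exp (Complex.I * ((2 * π / (N:ℝ) * (k i:ℝ) * ((n i : ℕ) : ℝ) : ℝ) : ℂ)) := by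
    intro n
    rw [← Complex.exp_sum]
    congr 1
    rw [← Finset.mul_sum, ← Complex.ofReal_sum]
    rfl
  simp_rw [h1]
  have h2 := Finset.prod_univ_sum (fun _ : Fin 3 => (Finset.univ : Finset (Fin N)))
    (fun i j => Complex.exp (Complex.I * ((2 * π / (N:ℝ) * (k i:ℝ) * ((j : ℕ) : ℝ) : ℝ) : ℂ)))
  rw [Fintype.piFinset_univ] at h2
  rw [← h2]
  simp_rw [geom1 hN]
  split_ifs with h
  · rw [Finset.prod_congr rfl (fun i _ => if_pos (h i))]; simp
  · unfold inGamma1 at h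
    push Not at h
    obtain ⟨i, hi⟩ := h
    exact Finset.prod_eq_zero (Finset.mem_univ i) (if_neg hi)

/-- integer vector of an index -/
def intG {N : ℕ} (n : GammaIdx N) : Fin 3 → ℤ := fun i => ((n i : ℕ) : ℤ)

lemma inversion {N : ℕ} (hN : 0 < N) (κ : GammaIdx N → V3) (a : Fin 3) (n : GammaIdx N) :
    ∑ k : GammaIdx N, Complex.exp (-(Complex.I * ((dotP (xiN N (intG k)) (embG n) : ℝ) : ℂ)))
      * hatK N κ (xiN N (intG k)) a = (N:ℂ)^3 * ((κ n a : ℝ) : ℂ) := by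
  classical
  have h1 : ∀ k m : GammaIdx N,
      Complex.exp (-(Complex.I * ((dotP (xiN N (intG k)) (embG n) : ℝ) : ℂ)))
      * Complex.exp (Complex.I * ((dotP (xiN N (intG k)) (embG m) : ℝ) : ℂ))
      = Complex.exp (Complex.I * ((dotP (xiN N (intG m - intG n)) (embG k) : ℝ) : ℂ)) := by
    intro k m
    rw [← Complex.exp_add]
    congr 1
    simp only [dotP, xiN, embG, intG, Fin.sum_univ_three, Pi.sub_apply]
    push_cast
    ring
  unfold hatK
  simp_rw [Finset.mul_sum, ← mul_assoc, h1]
  rw [Finset.sum_comm]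
  simp_rw [← Finset.sum_mul, geom3 hN]
  rw [Finset.sum_eq_single n]
  · rw [if_pos]
    intro i; simp
  · intro m _ hm
    rw [if_neg, zero_mul]
    intro h
    apply hm
    ext i
    have h2 := h i
    simp only [intG, Pi.sub_apply] at h2
    have := Int.eq_zero_of_abs_lt_dvd h2 (by
      have := (m i).2; have := (n i).2
      rw [abs_lt]; omega)
    omega
  · simp

lemma kappa_le {N : ℕ} (hN : 0 < N) (κ : GammaIdx N → V3) (a : Fin 3) (n : GammaIdx N) :
    |κ n a| ≤ ∑ k : GammaIdx N, ‖hatK N κ (xiN N (intG k)) a‖ := by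
  have h := congrArg norm (inversion hN κ a n)
  rw [norm_mul, norm_pow, Complex.norm_real, Real.norm_eq_abs, Complex.norm_natCast] at h
  have h1 : (1:ℝ) ≤ (N:ℝ)^3 := one_le_pow₀ (by exact_mod_cast hN)
  calc |κ n a| ≤ (N:ℝ)^3 * |κ n a| := le_mul_of_one_le_left (abs_nonneg _) h1
    _ ≤ _ := by
      rw [← h]
      refine (norm_sum_le _ _).trans (le_of_eq (Finset.sum_congr rfl fun k _ => ?_))
      rw [norm_mul, ← mul_neg, ← Complex.ofReal_neg, norm_exp_dot, one_mul]

lemma xi_add {N : ℕ} (hN : 0 < N) (k m : Fin 3 → ℤ) (i : Fin 3) :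
    xiN N k i + 2 * π * (m i : ℝ) = xiN N (k + (N:ℤ) • m) i := by
  have hN' : (N:ℝ) ≠ 0 := by exact_mod_cast hN.ne'
  simp only [xiN, Pi.add_apply, Pi.smul_apply, smul_eq_mul]
  push_cast
  field_simp

lemma wiener_span {N : ℕ} (hN : 0 < N) {σ : V3 → ℝ} (hW : WienerCond N σ)
    (k : Fin 3 → ℤ) (hk : ¬ inGamma1 N k) (a : Fin 3) :
    ∃ c : (Fin 3 → ℤ) →₀ ℝ,
      (∀ m ∈ c.support, fCoeffR N σ (xiN N (k + (N:ℤ) • m)) ≠ 0) ∧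
      ∀ v : Fin 3 → ℂ, v a = ∑ m ∈ c.support, (c m : ℂ) *
        ∑ i, (xiN N (k + (N:ℤ) • m) i : ℂ) * v i := by
  have hP := hW k hk
  set w : (Fin 3 → ℤ) → V3 := fun m => xiN N (k + (N:ℤ) • m) with hw
  set S : Set (Fin 3 → ℤ) := {m | fCoeffR N σ (w m) ≠ 0} with hS
  have hent : ∀ a b, SigMat N σ (xiN N k) a b
      = ∑' m, (w m a * w m b / nsqV (w m)) * Complex.normSq (fCoeffR N σ (w m)) := by
    intro a b
    have : ∀ m : Fin 3 → ℤ, (fun i => xiN N k i + 2 * π * (m i : ℝ)) = w m := by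
      intro m; ext i; exact xi_add hN k m i
    simp only [SigMat, Matrix.of_apply]
    congr 1
    ext m
    rw [this m, xi_add hN, xi_add hN]
  have hdiag : ∀ a, Summable fun m => (w m a * w m a / nsqV (w m)) * Complex.normSq (fCoeffR N σ (w m)) := by
    intro a
    by_contra hns
    have h1 : 0 < SigMat N σ (xiN N k) a a := hP.diag_pos
    rw [hent, tsum_eq_zero_of_not_summable hns] at h1
    exact lt_irrefl _ h1
  have hsum : ∀ a b, Summable fun m => (w m a * w m b / nsqV (w m)) * Complex.normSq (fCoeffR N σ (w m)) := by
    intro a b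
    refine Summable.of_norm_bounded ((hdiag a).add (hdiag b)) ?_
    intro m
    rw [Real.norm_eq_abs, abs_mul, abs_div, abs_of_nonneg (nsqV_nonneg _),
      abs_of_nonneg (Complex.normSq_nonneg _), ← add_mul, ← add_div]
    have h2 := nsqV_nonneg (w m)
    have h3 := Complex.normSq_nonneg (fCoeffR N σ (w m))
    gcongr
    rw [abs_le]
    constructor <;> nlinarith [sq_nonneg (w m a + w m b), sq_nonneg (w m a - w m b)]
  have htop : Submodule.span ℝ (w '' S) = ⊤ := by
    by_contra hne
    obtain ⟨f, hf0, hf⟩ := Submodule.exists_le_ker_of_lt_top _ (lt_top_iff_ne_top.2 hne)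
    set v : V3 := fun i => f (Pi.single i 1) with hv
    have hfv : ∀ x : V3, f x = ∑ i, x i * v i := by
      intro x
      have hx : x = ∑ i, x i • (Pi.single i 1 : V3) := by
        ext j; simp [Finset.sum_apply, Pi.single_apply]
      conv_lhs => rw [hx]
      simp [hv]
    have hv0 : v ≠ 0 := by
      intro h
      apply hf0
      ext x
      simp
      have := congrFun h x
      simpa [hv] using this
    have hpos := hP.dotProduct_mulVec_pos hv0
    have hzero : star v ⬝ᵥ (SigMat N σ (xiN N k)).mulVec v = 0 := by
      have e : star v ⬝ᵥ (SigMat N σ (xiN N k)).mulVec v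
          = ∑ a, ∑ b, v a * v b * SigMat N σ (xiN N k) a b := by
        simp only [dotProduct, Matrix.mulVec, Pi.star_apply, star_trivial, Finset.mul_sum]
        refine Finset.sum_congr rfl fun a _ => Finset.sum_congr rfl fun b _ => by ring
      rw [e]
      simp_rw [hent, ← tsum_mul_left]
      rw [Finset.sum_congr rfl (fun a _ => (Summable.tsum_finsetSum (fun b _ => (hsum a b).mul_left (v a * v b))).symm)]
      rw [← Summable.tsum_finsetSum (fun a _ => summable_sum (fun b _ => (hsum a b).mul_left (v a * v b)))]
      convert tsum_zero with m
      by_cases hm : m ∈ S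
      · have h0 : f (w m) = 0 := hf (Submodule.subset_span ⟨m, hm, rfl⟩)
        rw [hfv] at h0
        have : ∑ a, ∑ b, v a * v b * (w m a * w m b / nsqV (w m) * Complex.normSq (fCoeffR N σ (w m)))
          = (∑ i, w m i * v i)^2 * (Complex.normSq (fCoeffR N σ (w m)) / nsqV (w m)) := by
          rw [sq, Finset.sum_mul_sum, Finset.sum_mul]
          refine Finset.sum_congr rfl fun a _ => ?_
          rw [Finset.sum_mul]
          refine Finset.sum_congr rfl fun b _ => by ring
        rw [this, h0]; simp
      · have : fCoeffR N σ (w m) = 0 := by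
          by_contra h; exact hm h
        simp [this]
    rw [hzero] at hpos
    exact lt_irrefl _ hpos
  have hmem : (Pi.single a 1 : V3) ∈ Submodule.span ℝ (w '' S) := by rw [htop]; trivial
  rw [Finsupp.mem_span_image_iff_linearCombination] at hmem
  obtain ⟨c, hc, hl⟩ := hmem
  refine ⟨c, fun m hm => (Finsupp.mem_supported _ _).1 hc hm, ?_⟩
  intro v
  rw [Finsupp.linearCombination_apply, Finsupp.sum] at hl
  simp_rw [Finset.mul_sum]
  rw [Finset.sum_comm]
  have h1 : ∀ i, ∑ m ∈ c.support, (c m : ℂ) * ((w m i : ℂ) * v i) = ((Pi.single a 1 : V3) i : ℂ) * v i := by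
    intro i
    rw [← hl, Finset.sum_apply, Complex.ofReal_sum, Finset.sum_mul]
    refine Finset.sum_congr rfl fun m _ => ?_
    simp; ring
  rw [Finset.sum_congr rfl (fun i _ => h1 i)]
  rw [Finset.sum_eq_single a]
  · simp
  · intro b _ hb; simp [hb]
  · simp


/-- structure factor of the ions -/
def strF (N : ℕ) (q : GammaIdx N → V3) (ξ : V3) : ℂ :=
  ∑ n : GammaIdx N, Complex.exp (Complex.I * ((dotP ξ (embG n + q n) : ℝ) : ℂ))

lemma rho_coeff {N : ℕ} (hN : 0 < N) {σ : V3 → ℝ} (e : ℝ) (hper : IsPerN N σ) (hσ : Continuous σ)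
    {ψ : V3 → ℂ} (hψ : Continuous ψ) (q : GammaIdx N → V3) (k : Fin 3 → ℤ) :
    fCoeffR N (rhoT N σ e ψ q) (xiN N k) = fCoeffR N σ (xiN N k) * strF N q (xiN N k)
      - (e : ℂ) * fCoeffR N (fun x => Complex.normSq (ψ x)) (xiN N k) := by
  have hd := dotP_cont (xiN N k)
  have hn : Continuous (fun x => Complex.normSq (ψ x)) := Complex.continuous_normSq.comp hψ
  have hs : ∀ n : GammaIdx N, ∫ x in cubeN N, Complex.exp (Complex.I * ((dotP (xiN N k) x : ℝ) : ℂ))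
      * ((σ (x - embG n - q n) : ℝ) : ℂ) = Complex.exp (Complex.I * ((dotP (xiN N k) (embG n + q n) : ℝ) : ℂ))
        * fCoeffR N σ (xiN N k) := by
    intro n
    have := fCoeff_shift hN k (f := fun x => ((σ x : ℝ) : ℂ))
      (by intro x m; simp only [hper x m]) (embG n + q n)
    simp only [fCoeff, ← sub_sub] at this
    rw [this]; rfl
  unfold fCoeffR fCoeff rhoT
  have e1 : ∀ x, Complex.exp (Complex.I * ((dotP (xiN N k) x : ℝ) : ℂ)) *
      (((∑ n : GammaIdx N, σ (x - embG n - q n)) - e * Complex.normSq (ψ x) : ℝ) : ℂ)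
      = (∑ n : GammaIdx N, Complex.exp (Complex.I * ((dotP (xiN N k) x : ℝ) : ℂ)) * ((σ (x - embG n - q n) : ℝ) : ℂ))
        - (e : ℂ) * (Complex.exp (Complex.I * ((dotP (xiN N k) x : ℝ) : ℂ)) * ((Complex.normSq (ψ x) : ℝ) : ℂ)) := by
    intro x
    push_cast
    rw [mul_sub, Finset.mul_sum]
    ring
  simp_rw [e1]
  have hi : ∀ n ∈ (Finset.univ : Finset (GammaIdx N)), Integrable (fun x =>
      Complex.exp (Complex.I * ((dotP (xiN N k) x : ℝ) : ℂ)) * ((σ (x - embG n - q n) : ℝ) : ℂ))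
      (volume.restrict (cubeN N)) := fun n _ => cont_int N (by fun_prop)
  rw [integral_sub (integrable_finsetSum _ hi)
    (cont_int N (by fun_prop)), integral_const_mul,
    integral_finsetSum _ hi]
  simp_rw [hs]
  rw [← Finset.sum_mul, mul_comm]
  rfl

lemma rho_per {N : ℕ} {σ : V3 → ℝ} (e : ℝ) (hper : IsPerN N σ)
    {ψ : V3 → ℂ} (hψ : IsPerN N ψ) (q : GammaIdx N → V3) : IsPerN N (rhoT N σ e ψ q) := by
  intro x m
  simp only [rhoT, hψ x m]
  congr 1
  refine Finset.sum_congr rfl fun n _ => ?_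
  rw [← hper (x - embG n - q n) m]
  congr 1; abel

lemma rho_C1 {N : ℕ} {σ : V3 → ℝ} (e : ℝ) (hσ : ContDiff ℝ 2 σ)
    {ψ : V3 → ℂ} (hψ : ContDiff ℝ 1 ψ) (q : GammaIdx N → V3) : ContDiff ℝ 1 (rhoT N σ e ψ q) := by
  have h1 : ContDiff ℝ 1 σ := hσ.of_le (by norm_num)
  have h2 : ContDiff ℝ 1 (fun x => Complex.normSq (ψ x)) := by
    simp_rw [Complex.normSq_eq_norm_sq]
    exact hψ.norm_sq ℝ
  unfold rhoT
  refine ContDiff.sub (ContDiff.sum fun n _ => ?_) (contDiff_const.mul h2)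
  exact h1.comp ((contDiff_id.sub contDiff_const).sub contDiff_const)

lemma energy_bounds {N : ℕ} (hN : 0 < N) {σ : V3 → ℝ} {e M : ℝ} (hM : 0 < M) (hper : IsPerN N σ)
    (hσ : ContDiff ℝ 2 σ) {ψ : V3 → ℂ} (hψ : IsPerN N ψ) (hψc : ContDiff ℝ 1 ψ)
    (q p : GammaIdx N → V3) :
    (∫ x in cubeN N, gradSq ψ x) ≤ 2 * energyE N σ e M ψ q p ∧
    (∑ n, nsqV (p n)) ≤ 2 * M * energyE N σ e M ψ q p ∧
    ∀ k : Fin 3 → ℤ, k ≠ 0 → ‖fCoeffR N (rhoT N σ e ψ q) (xiN N k)‖ ^ 2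
      ≤ 2 * (N:ℝ)^3 * nsqV (xiN N k) * energyE N σ e M ψ q p := by
  have hG : 0 ≤ ∫ x in cubeN N, gradSq ψ x := integral_nonneg fun x => gradSq_nonneg ψ x
  have hP : 0 ≤ ∑ n, nsqV (p n) := Finset.sum_nonneg fun _ _ => nsqV_nonneg _
  have hterm : ∀ k : Fin 3 → ℤ, 0 ≤ (if k = 0 then 0 else
    Complex.normSq (fCoeffR N (rhoT N σ e ψ q) (xiN N k)) / nsqV (xiN N k)) := by
    intro k
    split_ifs
    · exact le_rfl
    · exact div_nonneg (Complex.normSq_nonneg _) (nsqV_nonneg _)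
  have hD : 0 ≤ dualSum N (rhoT N σ e ψ q) := tsum_nonneg hterm
  have hPM : 0 ≤ (2 * M)⁻¹ * ∑ n, nsqV (p n) := by positivity
  have hDN : 0 ≤ (2 * (N:ℝ)^3)⁻¹ * dualSum N (rhoT N σ e ψ q) := by positivity
  refine ⟨?_, ?_, ?_⟩
  · unfold energyE; linarith
  · have : (2 * M)⁻¹ * ∑ n, nsqV (p n) ≤ energyE N σ e M ψ q p := by unfold energyE; linarith
    rwa [inv_mul_le_iff₀ (by positivity)] at this
  · intro k hk
    have h1 : (2 * (N:ℝ)^3)⁻¹ * dualSum N (rhoT N σ e ψ q) ≤ energyE N σ e M ψ q p := by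
      unfold energyE; linarith
    rw [inv_mul_le_iff₀ (by positivity)] at h1
    have h2 := (dual_summable hN (rho_per e hper hψ q) (rho_C1 e hσ hψc q)).le_tsum k
      (fun j _ => hterm j)
    rw [if_neg hk, Complex.normSq_eq_norm_sq, div_le_iff₀ (nsqV_xi_pos hN hk)] at h2
    have h3 := nsqV_xi_pos hN hk
    calc _ ≤ _ := h2
      _ ≤ (2 * (N:ℝ)^3 * energyE N σ e M ψ q p) * nsqV (xiN N k) := by
        gcongr
        exact h1
      _ = _ := by ring

lemma str_bound {N : ℕ} (hN : 0 < N) {σ : V3 → ℝ} {e M Z : ℝ} (he : 0 < e) (hZ : 0 < Z) (hM : 0 < M) (hper : IsPerN N σ)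
    (hσ : ContDiff ℝ 2 σ) (k : Fin 3 → ℤ) (hk : k ≠ 0) :
    ∃ C : ℝ, 0 ≤ C ∧ ∀ (ψ : V3 → ℂ) (q p : GammaIdx N → V3), IsPerN N ψ → ContDiff ℝ 1 ψ →
      (∫ x in cubeN N, Complex.normSq (ψ x)) = Z * (N : ℝ) ^ 3 →
      ‖fCoeffR N σ (xiN N k)‖ * ‖strF N q (xiN N k)‖ ≤ C * √(energyE N σ e M ψ q p) := by
  have hx := nsqV_xi_pos hN hk
  refine ⟨√(2 * (N:ℝ)^3 * nsqV (xiN N k)) + e * √(π^2 / nsqV (xiN N k) * 2 * (Z * (N:ℝ)^3)),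
    by positivity, ?_⟩
  intro ψ q p hψ hψc hm
  obtain ⟨h1, -, h3⟩ := energy_bounds hN (e := e) hM hper hσ hψ hψc q p
  have h3 := h3 k hk
  have h4 := normSq_coeff hN hk hψ hψc
  have h5 := rho_coeff hN e hper hσ.continuous hψc.continuous q k
  set E := energyE N σ e M ψ q p
  rw [hm] at h4
  have h6 : ‖fCoeffR N (rhoT N σ e ψ q) (xiN N k)‖ ≤ √(2 * (N:ℝ)^3 * nsqV (xiN N k)) * √E := by
    rw [← Real.sqrt_mul (by positivity)]
    exact Real.le_sqrt_of_sq_le h3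
  have h7 : ‖fCoeffR N (fun x => Complex.normSq (ψ x)) (xiN N k)‖
      ≤ √(π^2 / nsqV (xiN N k) * 2 * (Z * (N:ℝ)^3)) * √E := by
    rw [← Real.sqrt_mul (by positivity)]
    apply Real.le_sqrt_of_sq_le
    calc _ ≤ _ := h4
      _ ≤ (π^2 / nsqV (xiN N k) * (2 * E)) * (Z * (N:ℝ)^3) := by gcongr
      _ = _ := by ring
  have h8 : fCoeffR N σ (xiN N k) * strF N q (xiN N k) = fCoeffR N (rhoT N σ e ψ q) (xiN N k)
      + (e:ℂ) * fCoeffR N (fun x => Complex.normSq (ψ x)) (xiN N k) := by rw [h5]; ring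
  rw [← norm_mul, h8]
  refine (norm_add_le _ _).trans ?_
  rw [norm_mul, Complex.norm_real, Real.norm_of_nonneg he.le, add_mul, mul_assoc e]
  gcongr

lemma exp_taylor (t : ℝ) : ‖Complex.exp (Complex.I * (t:ℂ)) - 1 - Complex.I * t‖ ≤ 2 * t ^ 2 := by
  by_cases ht : |t| ≤ 1
  · have := Complex.norm_exp_sub_one_sub_id_le (x := Complex.I * (t:ℂ)) (by simpa using ht)
    simp only [norm_mul, Complex.norm_I, one_mul, Complex.norm_real, Real.norm_eq_abs, sq_abs] at this
    nlinarith [sq_nonneg t]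
  · have h1 := Real.norm_exp_I_mul_ofReal_sub_one_le (x := t)
    have h2 : ‖Complex.I * (t:ℂ)‖ = |t| := by simp
    have h3 := norm_sub_le (Complex.exp (Complex.I * (t:ℂ)) - 1) (Complex.I * t)
    rw [Real.norm_eq_abs] at h1
    push Not at ht
    have : |t| ≤ t^2 := by rw [← sq_abs]; nlinarith
    linarith

lemma dotP_sq_le (u v : V3) : dotP u v ^ 2 ≤ nsqV u * nsqV v :=
  Finset.sum_mul_sq_le_sq_mul_sq _ _ _

lemma lin_bound {N : ℕ} (hN : 0 < N) (k : Fin 3 → ℤ) (hk : ¬ inGamma1 N k)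
    (q κ : GammaIdx N → V3) (r : V3) (m : GammaIdx N → Fin 3 → ℤ)
    (hq : ∀ n, q n = r + (fun i => (N:ℝ) * (m n i : ℝ)) + κ n) :
    ‖∑ i, (xiN N k i : ℂ) * hatK N κ (xiN N k) i‖
      ≤ ‖strF N q (xiN N k)‖ + 2 * nsqV (xiN N k) * ∑ n, nsqV (κ n) := by
  set ξ := xiN N k
  set T : ℂ := ∑ n : GammaIdx N, Complex.exp (Complex.I * ((dotP ξ (embG n) : ℝ) : ℂ))
      * Complex.exp (Complex.I * ((dotP ξ (κ n) : ℝ) : ℂ)) with hT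
  have h1 : ‖strF N q ξ‖ = ‖T‖ := by
    have : strF N q ξ = Complex.exp (Complex.I * ((dotP ξ r : ℝ) : ℂ)) * T := by
      rw [hT, strF, Finset.mul_sum]
      refine Finset.sum_congr rfl fun n _ => ?_
      rw [hq n, exp_split, exp_split, exp_split, exp_lattice hN]
      ring
    rw [this, norm_mul, norm_exp_dot, one_mul]
  have h2 : ∑ n : GammaIdx N, Complex.exp (Complex.I * ((dotP ξ (embG n) : ℝ) : ℂ)) = 0 := by
    classical
    rw [geom3 hN, if_neg hk]
  have h3 : Complex.I * ∑ i, (ξ i : ℂ) * hatK N κ ξ i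
      = T - ∑ n : GammaIdx N, Complex.exp (Complex.I * ((dotP ξ (embG n) : ℝ) : ℂ))
        * (Complex.exp (Complex.I * ((dotP ξ (κ n) : ℝ) : ℂ)) - 1 - Complex.I * ((dotP ξ (κ n) : ℝ) : ℂ)) := by
    have e1 : ∑ i, (ξ i : ℂ) * hatK N κ ξ i = ∑ n : GammaIdx N,
        Complex.exp (Complex.I * ((dotP ξ (embG n) : ℝ) : ℂ)) * ((dotP ξ (κ n) : ℝ) : ℂ) := by
      unfold hatK
      simp_rw [Finset.mul_sum]
      rw [Finset.sum_comm]
      refine Finset.sum_congr rfl fun n _ => ?_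
      have hdot : ((dotP ξ (κ n) : ℝ) : ℂ) = ∑ i, (ξ i : ℂ) * (κ n i : ℂ) := by simp [dotP]
      rw [hdot, Finset.mul_sum]
      refine Finset.sum_congr rfl fun i _ => ?_
      ring
    rw [e1, hT]
    simp_rw [mul_sub, mul_one]
    rw [Finset.sum_sub_distrib, Finset.sum_sub_distrib, h2, Finset.mul_sum]
    rw [sub_zero, sub_sub_cancel]
    refine Finset.sum_congr rfl fun n _ => by ring
  have h4 : ‖∑ i, (ξ i : ℂ) * hatK N κ ξ i‖ = ‖Complex.I * ∑ i, (ξ i : ℂ) * hatK N κ ξ i‖ := by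
    rw [norm_mul, Complex.norm_I, one_mul]
  rw [h4, h3, h1]
  refine (norm_sub_le _ _).trans ?_
  gcongr
  refine (norm_sum_le _ _).trans ?_
  rw [Finset.mul_sum]
  refine Finset.sum_le_sum fun n _ => ?_
  rw [norm_mul, norm_exp_dot, one_mul]
  have := exp_taylor (dotP ξ (κ n))
  have := dotP_sq_le ξ (κ n)
  linarith

lemma hatK_per {N : ℕ} (hN : 0 < N) (κ : GammaIdx N → V3) (k m : Fin 3 → ℤ) (a : Fin 3) :
    hatK N κ (xiN N (k + (N:ℤ) • m)) a = hatK N κ (xiN N k) a := by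
  have hN' : (N:ℂ) ≠ 0 := by exact_mod_cast hN.ne'
  unfold hatK
  refine Finset.sum_congr rfl fun n _ => ?_
  congr 1
  have : Complex.I * ((dotP (xiN N (k + (N:ℤ) • m)) (embG n) : ℝ) : ℂ)
      = Complex.I * ((dotP (xiN N k) (embG n) : ℝ) : ℂ)
        + ((∑ i, m i * intG n i : ℤ) : ℂ) * (2 * π * Complex.I) := by
    simp only [dotP, xiN, embG, intG, Fin.sum_univ_three, Pi.add_apply, Pi.smul_apply, smul_eq_mul]
    push_cast
    field_simp
    ring
  rw [this, Complex.exp_add, Complex.exp_int_mul_two_pi_mul_I, mul_one]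

lemma gamma1_shift {N : ℕ} {k : Fin 3 → ℤ} (hk : ¬ inGamma1 N k) (m : Fin 3 → ℤ) :
    ¬ inGamma1 N (k + (N:ℤ) • m) := by
  intro h
  apply hk
  intro i
  have := h i
  simp only [Pi.add_apply, Pi.smul_apply, smul_eq_mul] at this
  exact (Int.dvd_add_left (dvd_mul_right _ _)).1 this

lemma hat_bound {N : ℕ} (hN : 0 < N) {σ : V3 → ℝ} {e M Z : ℝ} (he : 0 < e) (hZ : 0 < Z) (hM : 0 < M)
    (hper : IsPerN N σ) (hσ : ContDiff ℝ 2 σ) (hW : WienerCond N σ)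
    (k : Fin 3 → ℤ) (a : Fin 3) :
    ∃ C : ℝ, 0 ≤ C ∧ ∀ (ψ : V3 → ℂ) (q p : GammaIdx N → V3), IsPerN N ψ → ContDiff ℝ 1 ψ →
      (∫ x in cubeN N, Complex.normSq (ψ x)) = Z * (N : ℝ) ^ 3 →
      ∀ (κ : GammaIdx N → V3) (r : V3) (m : GammaIdx N → Fin 3 → ℤ),
      (∀ n, q n = r + (fun i => (N:ℝ) * (m n i : ℝ)) + κ n) → (∀ a, ∑ n, κ n a = 0) →
      ‖hatK N κ (xiN N k) a‖ ≤ C * (√(energyE N σ e M ψ q p) + ∑ n, nsqV (κ n)) := by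
  by_cases hk : inGamma1 N k
  · refine ⟨0, le_rfl, ?_⟩
    intro ψ q p _ _ _ κ r m _ hκ
    have : hatK N κ (xiN N k) a = 0 := by
      choose j hj using hk
      have hkj : k = 0 + (N:ℤ) • j := by ext i; simp [hj i]
      rw [hkj, hatK_per hN]
      have h0 : ∀ n : GammaIdx N, dotP (xiN N 0) (embG n) = 0 := by intro n; simp [dotP, xiN]
      simp only [hatK, h0]
      simp only [Complex.ofReal_zero, mul_zero, Complex.exp_zero, one_mul]
      rw [← Complex.ofReal_sum, hκ a, Complex.ofReal_zero]
    rw [this]; simp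
  · obtain ⟨c, hc, hv⟩ := wiener_span hN hW k hk a
    have hne : ∀ m, k + (N:ℤ) • m ≠ 0 := by
      intro m h
      apply gamma1_shift hk m
      rw [h]; intro i; simp
    choose D hD0 hD using fun m : Fin 3 → ℤ => str_bound hN (σ := σ) (e := e) (M := M) (Z := Z)
      he hZ hM hper hσ (k + (N:ℤ) • m) (hne m)
    refine ⟨∑ m ∈ c.support, |c m| * (D m / ‖fCoeffR N σ (xiN N (k + (N:ℤ) • m))‖
      + 2 * nsqV (xiN N (k + (N:ℤ) • m))), ?_, ?_⟩
    · refine Finset.sum_nonneg fun m _ => ?_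
      have := hD0 m
      have := nsqV_nonneg (xiN N (k + (N:ℤ) • m))
      positivity
    · intro ψ q p h1 h2 h3 κ r m hq _
      have hva := hv (hatK N κ (xiN N k))
      rw [hva]
      refine (norm_sum_le _ _).trans ?_
      rw [Finset.sum_mul]
      refine Finset.sum_le_sum fun j hj => ?_
      rw [norm_mul, Complex.norm_real, Real.norm_eq_abs, mul_assoc]
      gcongr
      have hl := lin_bound hN _ (gamma1_shift hk j) q κ r m hq
      simp_rw [hatK_per hN] at hl
      have hs := hD j ψ q p h1 h2 h3
      have hpos : 0 < ‖fCoeffR N σ (xiN N (k + (N:ℤ) • j))‖ := norm_pos_iff.2 (hc j hj)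
      rw [mul_comm, ← le_div_iff₀ hpos] at hs
      refine hl.trans ?_
      set X := nsqV (xiN N (k + (N:ℤ) • j))
      have hX : 0 ≤ X := nsqV_nonneg _
      have hK : 0 ≤ ∑ n, nsqV (κ n) := Finset.sum_nonneg fun _ _ => nsqV_nonneg _
      have hE := Real.sqrt_nonneg (energyE N σ e M ψ q p)
      set DD := D j / ‖fCoeffR N σ (xiN N (k + (N:ℤ) • j))‖ with hDD
      have hDD0 : 0 ≤ DD := div_nonneg (hD0 j) hpos.le
      have hs' : ‖strF N q (xiN N (k + (N:ℤ) • j))‖ ≤ DD * √(energyE N σ e M ψ q p) := by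
        refine hs.trans (le_of_eq ?_)
        rw [hDD]; ring
      have e1 : 0 ≤ DD * ∑ n, nsqV (κ n) := by positivity
      have e2 : 0 ≤ 2 * X * √(energyE N σ e M ψ q p) := by positivity
      linarith

lemma kappa_bound {N : ℕ} (hN : 0 < N) {σ : V3 → ℝ} {e M Z : ℝ} (he : 0 < e) (hZ : 0 < Z) (hM : 0 < M)
    (hper : IsPerN N σ) (hσ : ContDiff ℝ 2 σ) (hW : WienerCond N σ) :
    ∃ C : ℝ, 0 ≤ C ∧ ∀ (ψ : V3 → ℂ) (q p : GammaIdx N → V3), IsPerN N ψ → ContDiff ℝ 1 ψ →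
      (∫ x in cubeN N, Complex.normSq (ψ x)) = Z * (N : ℝ) ^ 3 →
      ∀ (κ : GammaIdx N → V3) (r : V3) (m : GammaIdx N → Fin 3 → ℤ),
      (∀ n, q n = r + (fun i => (N:ℝ) * (m n i : ℝ)) + κ n) → (∀ a, ∑ n, κ n a = 0) →
      ∑ n, nsqV (κ n) ≤ C * (√(energyE N σ e M ψ q p) + ∑ n, nsqV (κ n)) ^ 2 := by
  choose C hC0 hC using fun (k : GammaIdx N) (a : Fin 3) => hat_bound hN (σ := σ) (e := e) (M := M) (Z := Z)
      he hZ hM hper hσ hW (intG k) a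
  refine ⟨∑ n : GammaIdx N, ∑ a, (∑ k, C k a)^2, by positivity, ?_⟩
  intro ψ q p h1 h2 h3 κ r m hq h0
  have hK : 0 ≤ ∑ n, nsqV (κ n) := Finset.sum_nonneg fun _ _ => nsqV_nonneg _
  have hE := Real.sqrt_nonneg (energyE N σ e M ψ q p)
  conv_lhs => unfold nsqV
  rw [Finset.sum_mul]
  refine Finset.sum_le_sum fun n _ => ?_
  rw [Finset.sum_mul]
  refine Finset.sum_le_sum fun a _ => ?_
  rw [← mul_pow, ← sq_abs]
  gcongr
  refine (kappa_le hN κ a n).trans ?_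
  rw [Finset.sum_mul]
  exact Finset.sum_le_sum fun k _ => hC k a ψ q p h1 h2 h3 κ r m hq h0

lemma psi_part {N : ℕ} (hN : 0 < N) {Z : ℝ} (hZ : 0 < Z) {ψ : V3 → ℂ} (hψ : IsPerN N ψ)
    (hψc : ContDiff ℝ 1 ψ) (hm : (∫ x in cubeN N, Complex.normSq (ψ x)) = Z * (N : ℝ) ^ 3) :
    ∃ α : ℝ, ∫ x in cubeN N,
        (Complex.normSq (ψ x - Complex.exp (Complex.I * (α : ℂ)) * ((Real.sqrt Z : ℝ) : ℂ))
          + gradSq ψ x) ≤ (6 * (N:ℝ)^2 + 1) * ∫ x in cubeN N, gradSq ψ x := by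
  have hP := poincare hN hψc hψ
  have hcf := hψc.continuous
  have hN0 : (0:ℝ) < (N:ℝ)^3 := by positivity
  set I0 := ∫ x in cubeN N, ψ x with hI0
  set c : ℂ := ((N:ℝ)^3)⁻¹ • I0 with hc
  have hIc : I0 = (N:ℝ)^3 • c := by rw [hc, smul_smul, mul_inv_cancel₀ hN0.ne', one_smul]
  set G := ∫ x in cubeN N, gradSq ψ x
  have hexp : ∀ u : ℂ, ∫ x in cubeN N, Complex.normSq (ψ x - u)
      = Z * (N:ℝ)^3 + (N:ℝ)^3 * Complex.normSq u - 2 * (N:ℝ)^3 * (c * (starRingEnd ℂ) u).re := by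
    intro u
    have hn : Continuous (fun x => Complex.normSq (ψ x)) := Complex.continuous_normSq.comp hcf
    simp_rw [Complex.normSq_sub]
    have hre : Continuous (fun x => (ψ x * (starRingEnd ℂ) u).re) :=
      Complex.continuous_re.comp (by fun_prop)
    rw [integral_sub (cont_int N (by fun_prop)) (cont_int N (by fun_prop)),
      integral_add (cont_int N (by fun_prop)) (cont_int N (by fun_prop)), hm, integral_const,
      cubeN_real_univ, integral_const_mul]
    have : ∫ x in cubeN N, (ψ x * (starRingEnd ℂ) u).re = (I0 * (starRingEnd ℂ) u).re := by
      rw [hI0, ← integral_mul_const]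
      exact integral_re (𝕜 := ℂ)
        (cont_int N (by fun_prop : Continuous fun x => ψ x * (starRingEnd ℂ) u))
    rw [this, hIc, smul_mul_assoc, Complex.smul_re, smul_eq_mul, smul_eq_mul]
    ring
  refine ⟨Complex.arg c, ?_⟩
  have hV := hexp c
  simp_rw [← Complex.normSq_eq_norm_sq] at hP
  rw [hV] at hP
  have hV0 : 0 ≤ ∫ x in cubeN N, Complex.normSq (ψ x - c) :=
    integral_nonneg fun _ => Complex.normSq_nonneg _
  rw [hV] at hV0
  have hpol : c = (‖c‖ : ℂ) * Complex.exp (Complex.I * (Complex.arg c : ℂ)) := by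
    rw [mul_comm Complex.I]; exact (Complex.norm_mul_exp_arg_mul_I c).symm
  set w := Complex.exp (Complex.I * (Complex.arg c : ℂ)) with hw
  have hw1 : w * (starRingEnd ℂ) w = 1 := by
    rw [Complex.mul_conj, Complex.normSq_eq_norm_sq, hw, norm_exp_dot]; simp
  have hcc : (c * (starRingEnd ℂ) c).re = ‖c‖^2 := by
    rw [Complex.mul_conj, Complex.normSq_eq_norm_sq, Complex.ofReal_re]
  have hcw : (c * (starRingEnd ℂ) (w * ((√Z : ℝ) : ℂ))).re = ‖c‖ * √Z := by
    have : c * (starRingEnd ℂ) (w * ((√Z : ℝ) : ℂ)) = ((‖c‖ * √Z : ℝ) : ℂ) := by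
      rw [map_mul, Complex.conj_ofReal]
      conv_lhs => rw [hpol]
      push_cast
      linear_combination (‖c‖ : ℂ) * ((√Z : ℝ) : ℂ) * hw1
    rw [this, Complex.ofReal_re]
  have hnw : Complex.normSq (w * ((√Z : ℝ) : ℂ)) = Z := by
    rw [Complex.normSq_eq_norm_sq, norm_mul, hw, norm_exp_dot, one_mul, Complex.norm_real,
      Real.norm_eq_abs, sq_abs, Real.sq_sqrt hZ.le]
  have hi : Integrable (fun x => Complex.normSq (ψ x - w * ((√Z : ℝ) : ℂ)))
      (volume.restrict (cubeN N)) :=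
    cont_int N (Complex.continuous_normSq.comp
      (by fun_prop : Continuous fun x => ψ x - w * ((√Z : ℝ) : ℂ)))
  rw [integral_add hi (cont_int N (gradSq_cont hψc)),
    hexp, hcw, hnw]
  rw [hcc, Complex.normSq_eq_norm_sq] at hP hV0
  have hs : √Z ^ 2 = Z := Real.sq_sqrt hZ.le
  have hs0 := Real.sqrt_pos.2 hZ
  have hle : ‖c‖ ≤ √Z := by
    apply Real.le_sqrt_of_sq_le
    have : 0 ≤ (N:ℝ)^3 * (Z - ‖c‖^2) := by linarith
    linarith [nonneg_of_mul_nonneg_right this hN0]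
  have key : Z * (N:ℝ)^3 + (N:ℝ)^3 * Z - 2 * (N:ℝ)^3 * (‖c‖ * √Z)
      ≤ 2 * (Z * (N:ℝ)^3 + (N:ℝ)^3 * ‖c‖^2 - 2 * (N:ℝ)^3 * ‖c‖^2) := by
    have h : 0 ≤ 2 * (N:ℝ)^3 * (‖c‖ * (√Z - ‖c‖)) := by
      have : 0 ≤ √Z - ‖c‖ := by linarith
      positivity
    linarith
  change _ + G ≤ _
  linarith


/-- The functional whose infimum is the distance. -/
def distF (N : ℕ) (Z : ℝ) (ψ : V3 → ℂ) (q p : GammaIdx N → V3) (α : ℝ) (r : V3) : ℝ :=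
    (Real.sqrt (∫ x in cubeN N,
        (Complex.normSq (ψ x - Complex.exp (Complex.I * (α : ℂ)) * ((Real.sqrt Z : ℝ) : ℂ))
          + gradSq ψ x))
      + Real.sqrt (∑ n : GammaIdx N, ⨅ k : Fin 3 → ℤ,
          nsqV (fun i => q n i - r i - (N : ℝ) * (k i : ℝ)))
      + Real.sqrt (∑ n : GammaIdx N, nsqV (p n)))

lemma distF_nonneg (N : ℕ) (Z : ℝ) (ψ : V3 → ℂ) (q p : GammaIdx N → V3) (α : ℝ) (r : V3) :
    0 ≤ distF N Z ψ q p α r := by unfold distF; positivity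

lemma distS_eq (N : ℕ) (Z : ℝ) (ψ : V3 → ℂ) (q p : GammaIdx N → V3) :
    distS N Z ψ q p = ⨅ (α : ℝ) (r : V3), distF N Z ψ q p α r := rfl

lemma distS_nonneg (N : ℕ) (Z : ℝ) (ψ : V3 → ℂ) (q p : GammaIdx N → V3) :
    0 ≤ distS N Z ψ q p := by
  rw [distS_eq]
  exact Real.iInf_nonneg fun α => Real.iInf_nonneg fun r => distF_nonneg ..

lemma distS_le (N : ℕ) (Z : ℝ) (ψ : V3 → ℂ) (q p : GammaIdx N → V3) (α : ℝ) (r : V3) :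
    distS N Z ψ q p ≤ distF N Z ψ q p α r := by
  rw [distS_eq]
  refine (ciInf_le ⟨0, ?_⟩ α).trans (ciInf_le ⟨0, ?_⟩ r)
  · rintro _ ⟨a, rfl⟩
    exact Real.iInf_nonneg fun r => distF_nonneg ..
  · rintro _ ⟨a, rfl⟩
    exact distF_nonneg ..

lemma inf_nonneg (N : ℕ) (q : V3) (r : V3) : 0 ≤ ⨅ k : Fin 3 → ℤ,
          nsqV (fun i => q i - r i - (N : ℝ) * (k i : ℝ)) :=
  Real.iInf_nonneg fun _ => nsqV_nonneg _

lemma decomp {N : ℕ} (hN : 0 < N) (Z : ℝ) (ψ : V3 → ℂ) (q p : GammaIdx N → V3) {δ : ℝ} (hδ : 0 < δ)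
    (h : distS N Z ψ q p ≤ δ) :
    ∃ (κ : GammaIdx N → V3) (r : V3) (m : GammaIdx N → Fin 3 → ℤ),
      (∀ n, q n = r + (fun i => (N:ℝ) * (m n i : ℝ)) + κ n) ∧ (∀ a, ∑ n, κ n a = 0) ∧
      ∑ n, nsqV (κ n) ≤ 4 * (N:ℝ)^3 * δ ^ 2 := by
  have hN0 : (0:ℝ) < (N:ℝ)^3 := by positivity
  have h1 : distS N Z ψ q p < 2 * δ := by linarith
  rw [distS_eq] at h1
  obtain ⟨α, h2⟩ := exists_lt_of_ciInf_lt h1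
  obtain ⟨r, h3⟩ := exists_lt_of_ciInf_lt h2
  have h4 : √(∑ n : GammaIdx N, ⨅ k : Fin 3 → ℤ,
          nsqV (fun i => q n i - r i - (N : ℝ) * (k i : ℝ))) < 2 * δ := by
    refine lt_of_le_of_lt ?_ h3
    unfold distF
    have a1 := Real.sqrt_nonneg (∫ x in cubeN N,
        (Complex.normSq (ψ x - Complex.exp (Complex.I * (α : ℂ)) * ((Real.sqrt Z : ℝ) : ℂ))
          + gradSq ψ x))
    have a2 := Real.sqrt_nonneg (∑ n : GammaIdx N, nsqV (p n))
    linarith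
  rw [Real.sqrt_lt' (by positivity)] at h4
  have h5 : ∀ n, ∃ k : Fin 3 → ℤ, nsqV (fun i => q n i - r i - (N : ℝ) * (k i : ℝ)) < (2 * δ)^2 := by
    intro n
    apply exists_lt_of_ciInf_lt
    refine lt_of_le_of_lt ?_ h4
    exact Finset.single_le_sum (f := fun n => ⨅ k : Fin 3 → ℤ,
          nsqV (fun i => q n i - r i - (N : ℝ) * (k i : ℝ))) (fun n _ => inf_nonneg N (q n) r) (Finset.mem_univ n)
  choose m hm using h5
  set κ0 : GammaIdx N → V3 := fun n i => q n i - r i - (N : ℝ) * (m n i : ℝ) with hκ0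
  set μ : V3 := fun i => ((N:ℝ)^3)⁻¹ * ∑ n, κ0 n i with hμ
  have hcard : (Fintype.card (GammaIdx N) : ℝ) = (N:ℝ)^3 := by simp
  have hmean : ∀ a, ∑ n, κ0 n a = (N:ℝ)^3 * μ a := by
    intro a; rw [hμ]; field_simp
  refine ⟨fun n i => κ0 n i - μ i, r + μ, m, ?_, ?_, ?_⟩
  · intro n
    ext i
    simp [hκ0]
    ring
  · intro a
    rw [Finset.sum_sub_distrib, hmean]
    simp
  · have h6 : ∑ n, nsqV (fun i => κ0 n i - μ i) ≤ ∑ n, nsqV (κ0 n) := by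
      unfold nsqV
      rw [Finset.sum_comm, Finset.sum_comm (f := fun n i => κ0 n i ^ 2)]
      refine Finset.sum_le_sum fun a _ => ?_
      have : ∑ n, (κ0 n a - μ a)^2 = ∑ n, κ0 n a ^ 2 - (N:ℝ)^3 * μ a ^ 2 := by
        have e : ∀ n, (κ0 n a - μ a)^2 = κ0 n a ^ 2 - 2 * μ a * κ0 n a + μ a ^ 2 := fun n => by ring
        simp_rw [e]
        rw [Finset.sum_add_distrib, Finset.sum_sub_distrib, ← Finset.mul_sum, hmean,
          Finset.sum_const, Finset.card_univ, nsmul_eq_mul, hcard]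
        ring
      rw [this]
      have : 0 ≤ (N:ℝ)^3 * μ a ^ 2 := by positivity
      linarith
    refine h6.trans ?_
    calc ∑ n, nsqV (κ0 n) ≤ ∑ n : GammaIdx N, (2 * δ)^2 := Finset.sum_le_sum fun n _ => (hm n).le
      _ = _ := by
        rw [Finset.sum_const, Finset.card_univ, nsmul_eq_mul, hcard]; ring


end helpers

/-- lower energy estimate near the solitary manifold. -/
theorem stmt18 (N : ℕ) (hN : 0 < N) (σ : V3 → ℝ) (e Z M : ℝ)
    (he : 0 < e) (hZ : 0 < Z) (hM : 0 < M)
    (hper : IsPerN N σ) (hreg : ContDiff ℝ 2 σ)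
    (hint : (∫ x in cubeN N, σ x) = e * Z)
    (hJ : JelliumCond N σ) (hW : WienerCond N σ) :
    ∃ ν > (0 : ℝ), ∃ δ > (0 : ℝ), ∀ (ψ : V3 → ℂ) (q p : GammaIdx N → V3),
      IsPerN N ψ → ContDiff ℝ 1 ψ →
      (∫ x in cubeN N, Complex.normSq (ψ x)) = Z * (N : ℝ) ^ 3 →
      distS N Z ψ q p ≤ δ →
      energyE N σ e M ψ q p ≥ ν * distS N Z ψ q p ^ 2 := by
  obtain ⟨C, hC0, hC⟩ := kappa_bound hN (σ := σ) (e := e) (M := M) (Z := Z) he hZ hM hper hreg hW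
  have hN1 : (1:ℝ) ≤ (N:ℝ)^3 := one_le_pow₀ (by exact_mod_cast hN)
  have hN0 : (0:ℝ) < (N:ℝ)^3 := by positivity
  set A : ℝ := 3 * ((6 * (N:ℝ)^2 + 1) * 2 + 4 * C + 2 * M) with hA
  have hA0 : 0 < A := by positivity
  refine ⟨A⁻¹, by positivity, (4 * (N:ℝ)^3 * (4 * C + 1))⁻¹, by positivity, ?_⟩
  intro ψ q p hψ hψc hm hd
  set δ : ℝ := (4 * (N:ℝ)^3 * (4 * C + 1))⁻¹ with hδ
  have hδ0 : 0 < δ := by positivity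
  have hδ1 : δ ≤ 1 := by
    rw [hδ]
    apply inv_le_one_of_one_le₀
    nlinarith [mul_nonneg hN0.le hC0]
  obtain ⟨κ, r, m, hq, hκ0, hκ⟩ := decomp hN Z ψ q p hδ0 hd
  obtain ⟨α, hα⟩ := psi_part hN hZ hψ hψc hm
  obtain ⟨hE1, hE2, -⟩ := energy_bounds hN (e := e) hM hper hreg hψ hψc q p
  have hK := hC ψ q p hψ hψc hm κ r m hq hκ0
  have hdist := distS_le N Z ψ q p α r
  have hd0 := distS_nonneg N Z ψ q p
  have hG : 0 ≤ ∫ x in cubeN N, gradSq ψ x := integral_nonneg fun x => gradSq_nonneg ψ x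
  set E := energyE N σ e M ψ q p
  have hE0 : 0 ≤ E := by linarith
  have hKn : 0 ≤ ∑ n, nsqV (κ n) := Finset.sum_nonneg fun _ _ => nsqV_nonneg _
  have hinf : ∑ n : GammaIdx N, (⨅ k : Fin 3 → ℤ,
      nsqV (fun i => q n i - r i - (N : ℝ) * (k i : ℝ))) ≤ ∑ n, nsqV (κ n) := by
    refine Finset.sum_le_sum fun n _ => ?_
    refine (ciInf_le ⟨0, ?_⟩ (m n)).trans (le_of_eq ?_)
    · rintro _ ⟨k, rfl⟩
      exact nsqV_nonneg _
    · congr 1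
      ext i
      rw [hq n]
      simp
      ring
  set K := ∑ n, nsqV (κ n)
  have hKs : K * (4 * C + 1) ≤ 1 := by
    have h1 : 4 * (N:ℝ)^3 * (4 * C + 1) * δ = 1 := by
      rw [hδ]; apply mul_inv_cancel₀; positivity
    calc K * (4 * C + 1) ≤ 4 * (N:ℝ)^3 * δ ^ 2 * (4 * C + 1) := by gcongr
      _ = (4 * (N:ℝ)^3 * (4 * C + 1) * δ) * δ := by ring
      _ ≤ 1 := by rw [h1]; linarith
  have hKE : K ≤ 4 * C * E := by
    have hs : √E ^ 2 = E := Real.sq_sqrt hE0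
    have h1 : (√E + K)^2 ≤ 2 * E + 2 * K^2 := by nlinarith [sq_nonneg (√E - K)]
    have h2 : K ≤ C * (2 * E + 2 * K^2) := hK.trans (by gcongr)
    have h3 : K * (K * (4 * C + 1)) ≤ K * 1 := by gcongr
    nlinarith [sq_nonneg K]
  have hfin : distF N Z ψ q p α r ≤ √((6 * (N:ℝ)^2 + 1) * (2 * E)) + √(4 * C * E) + √(2 * M * E) := by
    unfold distF
    refine add_le_add (add_le_add (Real.sqrt_le_sqrt ?_) (Real.sqrt_le_sqrt (hinf.trans hKE)))
      (Real.sqrt_le_sqrt hE2)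
    exact hα.trans (by gcongr)
  have hsq : distS N Z ψ q p ^ 2 ≤ A * E := by
    have hle := hdist.trans hfin
    set a := √((6 * (N:ℝ)^2 + 1) * (2 * E)) with ha
    set b := √(4 * C * E) with hb
    set c := √(2 * M * E) with hc
    have ha2 : a ^ 2 = (6 * (N:ℝ)^2 + 1) * (2 * E) := Real.sq_sqrt (by positivity)
    have hb2 : b ^ 2 = 4 * C * E := Real.sq_sqrt (by positivity)
    have hc2 : c ^ 2 = 2 * M * E := Real.sq_sqrt (by positivity)
    calc distS N Z ψ q p ^ 2 ≤ (a + b + c)^2 := by gcongr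
      _ ≤ 3 * (a^2 + b^2 + c^2) := by nlinarith [sq_nonneg (a - b), sq_nonneg (b - c), sq_nonneg (a - c)]
      _ = A * E := by rw [ha2, hb2, hc2, hA]; ring
  rw [ge_iff_le, inv_mul_le_iff₀ hA0]
  exact hsq

end SPN
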